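/- arXiv:2211.17245 — 11 statements merged into one kernel-verified Lean document; each statement's English description precedes it below -/
import Mathlib

section
/- Let φ : L⁰ → [−∞,∞] be a monetary risk measure. Then the restriction of φ to L^∞ is maxitive and continuous from below on L^∞ if and only if there exists a measurable function I : X → [0,∞] such that φ(f) = ess.sup_X(f − I) for every f ∈ L^∞. -/
open MeasureTheory Filter Set Topology ENNReal

noncomputable section

variable {X : Type*} [MeasurableSpace X]

/-- Membership in `L^∞(μ)`: (an a.e.-class of) a measurable, μ-essentially bounded function. -/
def MemLinf (μ : Measure X) (f : X → ℝ) : Prop :=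
  Measurable f ∧ ∃ C : ℝ, ∀ᵐ x ∂μ, |f x| ≤ C

/-- A monetary risk measure on `L⁰`: normalized, monotone (w.r.t. the μ-a.s. order) and
translation invariant. -/
def IsMonetaryRiskMeasure (μ : Measure X) (φ : (X → ℝ) → EReal) : Prop :=
  φ (fun _ => 0) = 0 ∧
    (∀ f g : X → ℝ, Measurable f → Measurable g → (∀ᵐ x ∂μ, f x ≤ g x) → φ f ≤ φ g) ∧
    (∀ f : X → ℝ, Measurable f → ∀ c : ℝ, φ (fun x => f x + c) = φ f + (c : EReal))

/-- `φ` is maxitive on `L^∞`. -/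
def MaxitiveLinf (μ : Measure X) (φ : (X → ℝ) → EReal) : Prop :=
  ∀ f g : X → ℝ, MemLinf μ f → MemLinf μ g →
    φ (fun x => max (f x) (g x)) ≤ max (φ f) (φ g)

/-- `φ` is continuous from below on `L^∞`: if `f n ↑ g` μ-a.s. with all `f n, g ∈ L^∞`,
then `φ (f n) ↑ φ g`. -/
def ContFromBelowLinf (μ : Measure X) (φ : (X → ℝ) → EReal) : Prop :=
  ∀ (f : ℕ → X → ℝ) (g : X → ℝ), (∀ n, MemLinf μ (f n)) → MemLinf μ g →
    (∀ᵐ x ∂μ, Monotone fun n => f n x) →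
    (∀ᵐ x ∂μ, Tendsto (fun n => f n x) atTop (𝓝 (g x))) →
    (⨆ n, φ (f n)) = φ g

/-- A nonempty family of measurable functions closed under maxima contains an increasing sequence
whose pointwise supremum dominates almost everywhere each member of the family. -/
theorem exists_monotone_seq_ae_dominating (μ : Measure X)
    [IsFiniteMeasure μ] (p : (X → ℝ) → Prop) (hne : ∃ f, p f) (hmeas : ∀ f, p f → Measurable f)
    (hsup : ∀ f g, p f → p g → p (f ⊔ g)) :
    ∃ g : ℕ → X → ℝ, (∀ n, p (g n)) ∧ Monotone g ∧
      ∀ f, p f → ∀ᵐ x ∂μ, ∀ b, (∀ n, g n x ≤ b) → f x ≤ b := by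
  let h : ℝ → ℝ≥0∞ := fun t => ENNReal.ofReal (Real.arctan t + Real.pi / 2)
  have h_mono : StrictMono h := fun s t hst => by
    have hs := Real.neg_pi_div_two_lt_arctan s
    have hlt := Real.arctan_strictMono hst
    exact (ENNReal.ofReal_lt_ofReal_iff (by linarith)).2 (by linarith)
  have h_meas : Measurable h := h_mono.monotone.measurable
  have h_le : ∀ t, h t ≤ ENNReal.ofReal Real.pi := fun t =>
    ENNReal.ofReal_le_ofReal (by linarith [Real.arctan_lt_pi_div_two t])
  let J : (X → ℝ) → ℝ≥0∞ := fun f => ∫⁻ x, h (f x) ∂μ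
  have J_mono : Monotone J := fun f g hfg => lintegral_mono fun x => h_mono.monotone (hfg x)
  obtain ⟨u, -, hu_lim, hu_mem⟩ := exists_seq_tendsto_sSup (S := J '' {f | p f})
    (Set.Nonempty.image J hne) (OrderTop.bddAbove _)
  choose v hv hvu using hu_mem
  have hp : ∀ n, p (partialSups v n) := by
    intro n
    induction n with
    | zero => simpa using hv 0
    | succ n ih => rw [partialSups_add_one]; exact hsup _ _ ih (hv _)
  refine ⟨partialSups v, hp, (partialSups v).monotone, fun f hf => ?_⟩
  have J_iSup : ∀ w : ℕ → X → ℝ, (∀ n, p (w n)) → Monotone w →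
      ∫⁻ x, ⨆ n, h (w n x) ∂μ = ⨆ n, J (w n) := fun w hw hwm =>
    lintegral_iSup (fun n => h_meas.comp (hmeas _ (hw n)))
      fun m n hmn x => h_mono.monotone (hwm hmn x)
  have le_lower : sSup (J '' {f | p f}) ≤ ∫⁻ x, ⨆ n, h (partialSups v n x) ∂μ := by
    rw [J_iSup _ hp (partialSups v).monotone]
    refine le_of_tendsto' hu_lim fun n => ?_
    rw [← hvu n]
    exact (J_mono (le_partialSups v n)).trans (le_iSup (fun n => J (partialSups v n)) n)
  have upper_le : ∫⁻ x, ⨆ n, h ((partialSups v n ⊔ f) x) ∂μ ≤ sSup (J '' {f | p f}) := by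
    rw [J_iSup _ (fun n => hsup _ _ (hp n) hf)
      fun m n hmn => sup_le_sup_right ((partialSups v).monotone hmn) f]
    exact iSup_le fun n => le_sSup ⟨_, hsup _ _ (hp n) hf, rfl⟩
  have lower_ne_top : ∫⁻ x, ⨆ n, h (partialSups v n x) ∂μ ≠ ∞ := by
    refine ne_top_of_le_ne_top ?_ (lintegral_mono fun x => iSup_le fun n => h_le _)
    rw [lintegral_const]
    exact ENNReal.mul_ne_top ENNReal.ofReal_ne_top (measure_ne_top _ _)
  have ae_eq := ae_eq_of_ae_le_of_lintegral_le
    (Eventually.of_forall fun x => iSup_mono fun n =>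
      h_mono.monotone (le_sup_left : partialSups v n x ≤ partialSups v n x ⊔ f x))
    lower_ne_top
    (Measurable.iSup fun n => h_meas.comp (hmeas _ (hsup _ _ (hp n) hf))).aemeasurable
    (upper_le.trans le_lower)
  filter_upwards [ae_eq] with x hx b hb
  refine h_mono.le_iff_le.1 ?_
  calc h (f x) ≤ h ((partialSups v 0 ⊔ f) x) := h_mono.monotone le_sup_right
    _ ≤ ⨆ n, h ((partialSups v n ⊔ f) x) := le_iSup (fun n => h ((partialSups v n ⊔ f) x)) 0
    _ = ⨆ n, h (partialSups v n x) := hx.symm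
    _ ≤ h b := iSup_le fun n => h_mono.monotone (hb n)

section MemLinf

variable {μ : Measure X} {f g : X → ℝ}

theorem MemLinf.sup (hf : MemLinf μ f) (hg : MemLinf μ g) : MemLinf μ (f ⊔ g) := by
  obtain ⟨hfm, C, hC⟩ := hf
  obtain ⟨hgm, D, hD⟩ := hg
  refine ⟨hfm.sup hgm, max C D, ?_⟩
  filter_upwards [hC, hD] with x hx hy
  exact abs_max_le_max_abs_abs.trans (max_le_max hx hy)

theorem MemLinf.inf (hf : MemLinf μ f) (hg : MemLinf μ g) : MemLinf μ (f ⊓ g) := by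
  obtain ⟨hfm, C, hC⟩ := hf
  obtain ⟨hgm, D, hD⟩ := hg
  refine ⟨hfm.inf hgm, max C D, ?_⟩
  filter_upwards [hC, hD] with x hx hy
  exact abs_min_le_max_abs_abs.trans (max_le_max hx hy)

theorem MemLinf.add_const (hf : MemLinf μ f) (c : ℝ) : MemLinf μ fun x => f x + c := by
  obtain ⟨hfm, C, hC⟩ := hf
  refine ⟨hfm.add_const c, C + |c|, ?_⟩
  filter_upwards [hC] with x hx
  exact (abs_add_le _ _).trans (by gcongr)

theorem memLinf_zero (μ : Measure X) : MemLinf μ fun _ => 0 :=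
  ⟨measurable_const, 0, by simp⟩

/-- A monetary risk measure is finite on `L^∞`. -/
theorem IsMonetaryRiskMeasure.exists_eq_coe {φ : (X → ℝ) → EReal}
    (hφ : IsMonetaryRiskMeasure μ φ) (hf : MemLinf μ f) : ∃ r : ℝ, φ f = r := by
  obtain ⟨h_zero, h_mono, h_add⟩ := hφ
  obtain ⟨hfm, C, hC⟩ := hf
  have h_const : ∀ c : ℝ, φ (fun _ => c) = c := fun c => by
    simpa [h_zero] using h_add (fun _ => 0) measurable_const c
  have h_upper : φ f ≤ (C : ℝ) := by
    rw [← h_const]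
    exact h_mono _ _ hfm measurable_const (hC.mono fun x hx => (abs_le.1 hx).2)
  have h_lower : ((-C : ℝ) : EReal) ≤ φ f := by
    rw [← h_const]
    exact h_mono _ _ measurable_const hfm (hC.mono fun x hx => (abs_le.1 hx).1)
  refine ⟨(φ f).toReal, (EReal.coe_toReal ?_ ?_).symm⟩
  · exact ne_top_of_le_ne_top (EReal.coe_ne_top _) h_upper
  · exact ne_bot_of_le_ne_bot (EReal.coe_ne_bot _) h_lower

end MemLinf

section PenalizedMaxLoss

variable {μ : Measure X} {φ : (X → ℝ) → EReal} {I : X → ℝ≥0∞}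

theorem maxitiveLinf_of_eq_essSup
    (hI : ∀ f, MemLinf μ f → φ f = essSup (fun x => (f x : EReal) - (I x : EReal)) μ) :
    MaxitiveLinf μ φ := by
  intro f g hf hg
  rw [hI f hf, hI g hg, hI (fun x => max (f x) (g x)) (hf.sup hg)]
  refine essSup_le_of_ae_le _ ?_
  filter_upwards [ae_le_essSup (μ := μ) (f := fun x => (f x : EReal) - (I x : EReal)),
    ae_le_essSup (μ := μ) (f := fun x => (g x : EReal) - (I x : EReal))] with x hx hy
  rcases le_total (f x) (g x) with h | h
  · simpa only [max_eq_right h] using hy.trans (le_max_right _ _)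
  · simpa only [max_eq_left h] using hx.trans (le_max_left _ _)

theorem contFromBelowLinf_of_eq_essSup (hφ : IsMonetaryRiskMeasure μ φ)
    (hI : ∀ f, MemLinf μ f → φ f = essSup (fun x => (f x : EReal) - (I x : EReal)) μ) :
    ContFromBelowLinf μ φ := by
  intro f g hf hg h_mono h_lim
  apply le_antisymm
  · refine iSup_le fun n => hφ.2.1 _ _ (hf n).1 hg.1 ?_
    filter_upwards [h_mono, h_lim] with x hx hy
    exact hx.ge_of_tendsto hy n
  · rw [hI g hg]
    refine essSup_le_of_ae_le _ ?_
    have h_le : ∀ᵐ x ∂μ, ∀ n, (f n x : EReal) - (I x : EReal) ≤ ⨆ n, φ (f n) := by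
      refine ae_all_iff.2 fun n => ?_
      filter_upwards [ae_le_essSup (μ := μ) (f := fun x => (f n x : EReal) - (I x : EReal))]
        with x hx
      rw [← hI _ (hf n)] at hx
      exact hx.trans (le_iSup (fun n => φ (f n)) n)
    filter_upwards [h_le, h_lim] with x hx hy
    rcases eq_or_ne (I x) ∞ with h_top | h_top
    · simp [h_top]
    · lift I x to NNReal using h_top with r
      refine le_of_tendsto'
        ((continuous_coe_real_ereal.tendsto _).comp (hy.sub_const (r : ℝ))) fun n => ?_
      exact hx n

theorem exists_penalty_of_maxitive_of_contFromBelow [IsFiniteMeasure μ]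
    (hφ : IsMonetaryRiskMeasure μ φ) (h_max : MaxitiveLinf μ φ) (h_cont : ContFromBelowLinf μ φ) :
    ∃ I : X → ℝ≥0∞, Measurable I ∧
      ∀ f, MemLinf μ f → φ f = essSup (fun x => (f x : EReal) - (I x : EReal)) μ := by
  have hφ_coe := fun f (hf : MemLinf μ f) => hφ.exists_eq_coe hf
  obtain ⟨h_zero, h_mono, h_add⟩ := hφ
  have p_zero : MemLinf μ (fun _ => 0) ∧ φ (fun _ => 0) ≤ 0 := ⟨memLinf_zero μ, h_zero.le⟩
  obtain ⟨g, hg, g_mono, hg_dom⟩ := exists_monotone_seq_ae_dominating μ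
    (fun f => MemLinf μ f ∧ φ f ≤ 0) ⟨_, p_zero⟩ (fun f hf => hf.1.1)
    fun f f' hf hf' => ⟨hf.1.sup hf'.1, (h_max _ _ hf.1 hf'.1).trans (max_le hf.2 hf'.2)⟩
  refine ⟨fun x => ⨆ n, ENNReal.ofReal (g n x),
    Measurable.iSup fun n => (hg n).1.1.ennreal_ofReal, fun f hf => le_antisymm ?_ ?_⟩
  · refine EReal.le_of_forall_lt_iff_le.1 fun c hc => ?_
    have h_neg := hf.add_const (-c)
    have h_acc : φ (fun x => f x + -c) ≤ 0 := by
      rw [← h_cont (fun n => g n ⊓ fun x => f x + -c) _ (fun n => (hg n).1.inf h_neg) h_neg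
        (Eventually.of_forall fun x m n hmn => inf_le_inf_right _ (g_mono hmn x)) ?_]
      · exact iSup_le fun n => (h_mono _ _ ((hg n).1.inf h_neg).1 (hg n).1.1
          (Eventually.of_forall fun x => inf_le_left)).trans (hg n).2
      · filter_upwards [hg_dom _ p_zero, ae_le_essSup (μ := μ)
          (f := fun x => (f x : EReal) - ((⨆ n, ENNReal.ofReal (g n x) : ℝ≥0∞) : EReal))]
          with x hx0 hx
        refine tendsto_atTop_isLUB (fun m n hmn => inf_le_inf_right _ (g_mono hmn x))
          ⟨?_, fun b hb => ?_⟩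
        · rintro _ ⟨n, rfl⟩
          exact inf_le_right
        · by_contra! hlt
          have hgb : ∀ n, g n x ≤ b := fun n =>
            (inf_le_iff.1 (hb ⟨n, rfl⟩)).resolve_right hlt.not_ge
          have hI_le : ((⨆ n, ENNReal.ofReal (g n x) : ℝ≥0∞) : EReal) ≤ (b : EReal) := by
            have := EReal.coe_ennreal_le_coe_ennreal_iff.2
              (iSup_le fun n => ENNReal.ofReal_le_ofReal (hgb n))
            rwa [EReal.coe_ennreal_ofReal, max_eq_left (hx0 b hgb)] at this
          have : ((f x - b : ℝ) : EReal) ≤ c := by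
            rw [EReal.coe_sub]
            exact (EReal.sub_le_sub le_rfl hI_le).trans (hx.trans hc.le)
          have := EReal.coe_le_coe_iff.1 this
          linarith
    rw [h_add f hf.1] at h_acc
    obtain ⟨r, hr⟩ := hφ_coe f hf
    rw [hr] at h_acc ⊢
    norm_cast at h_acc ⊢
    linarith
  · obtain ⟨r, hr⟩ := hφ_coe f hf
    rw [hr]
    refine essSup_le_of_ae_le _ ?_
    have h_acc : φ (fun x => f x + -r) ≤ 0 := by
      rw [h_add f hf.1, hr]
      norm_cast
      simp
    filter_upwards [hg_dom _ ⟨hf.add_const (-r), h_acc⟩] with x hx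
    generalize hs : (⨆ n, ENNReal.ofReal (g n x)) = s
    rcases eq_or_ne s ∞ with h_top | h_top
    · simp [h_top]
    · lift s to NNReal using h_top
      have : f x + -r ≤ s := hx s fun n => by
        have h_le : ENNReal.ofReal (g n x) ≤ s :=
          hs ▸ le_iSup (fun n => ENNReal.ofReal (g n x)) n
        rw [ENNReal.ofReal_le_iff_le_toReal ENNReal.coe_ne_top] at h_le
        simpa using h_le
      change (((f x - s : ℝ)) : EReal) ≤ r
      exact EReal.coe_le_coe_iff.2 (by linarith)

end PenalizedMaxLoss

/-- A monetary risk measure is maxitive and continuous from below on `L^∞` iff it is a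
penalized maximum loss `f ↦ ess.sup_X (f - I)` on `L^∞`, for some measurable penalty
`I : X → [0,∞]`. -/
theorem maxitive_contFromBelow_iff_penalizedMaxLoss
    (μ : Measure X) [IsProbabilityMeasure μ]
    (φ : (X → ℝ) → EReal) (hφ : IsMonetaryRiskMeasure μ φ) :
    (MaxitiveLinf μ φ ∧ ContFromBelowLinf μ φ) ↔
      ∃ I : X → ℝ≥0∞, Measurable I ∧
        ∀ f : X → ℝ, MemLinf μ f →
          φ f = essSup (fun x => (f x : EReal) - (I x : EReal)) μ := by
  constructor
  · rintro ⟨h_max, h_cont⟩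
    exact exists_penalty_of_maxitive_of_contFromBelow hφ h_max h_cont
  · rintro ⟨I, -, hI⟩
    exact ⟨maxitiveLinf_of_eq_essSup hI, contFromBelowLinf_of_eq_essSup hφ hI⟩
end
end

section
/- Let φ : L⁰ → [−∞,∞] be a monetary risk measure. Then the restriction of φ to L^∞ is maxitive and continuous from below on L^∞ if and only if the restriction of φ to L^∞ is σ-maxitive on L^∞, i.e. φ(sup_{n∈ℕ} f_n) ≤ sup_{n∈ℕ} φ(f_n) for every sequence (f_n) in L^∞ with sup_{n∈ℕ} f_n ∈ L^∞. -/
open MeasureTheory Filter Set Topology ENNReal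

noncomputable section

variable {X : Type*} [MeasurableSpace X]

/-- `φ` is σ-maxitive on `L^∞`: for every sequence `(f n)` in `L^∞` whose (a.s. pointwise)
supremum `g` again belongs to `L^∞`, one has `φ g ≤ ⨆ n, φ (f n)`. -/
def SigmaMaxitiveLinf (μ : Measure X) (φ : (X → ℝ) → EReal) : Prop :=
  ∀ (f : ℕ → X → ℝ) (g : X → ℝ), (∀ n, MemLinf μ (f n)) → MemLinf μ g →
    (∀ᵐ x ∂μ, BddAbove (range fun n => f n x)) →
    (∀ᵐ x ∂μ, g x = ⨆ n, f n x) →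
    φ g ≤ ⨆ n, φ (f n)

section

variable {μ : Measure X} {φ : (X → ℝ) → EReal}

theorem MemLinf.max {f g : X → ℝ} (hf : MemLinf μ f) (hg : MemLinf μ g) :
    MemLinf μ (fun x => max (f x) (g x)) := by
  obtain ⟨hfm, C, hC⟩ := hf
  obtain ⟨hgm, D, hD⟩ := hg
  refine ⟨hfm.max hgm, Max.max C D, ?_⟩
  filter_upwards [hC, hD] with x h₁ h₂
  exact abs_max_le_max_abs_abs.trans (max_le_max h₁ h₂)

theorem partialSups_succ_eq_fun_max {Y : Type*} (f : ℕ → Y → ℝ) (n : ℕ) :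
    partialSups f (n + 1) = fun x => max (partialSups f n x) (f (n + 1) x) :=
  partialSups_add_one f n

theorem memLinf_partialSups {f : ℕ → X → ℝ} (hf : ∀ n, MemLinf μ (f n)) (n : ℕ) :
    MemLinf μ (partialSups f n) := by
  induction n with
  | zero => simpa using hf 0
  | succ n ih =>
    rw [partialSups_succ_eq_fun_max]
    exact ih.max (hf (n + 1))

theorem MaxitiveLinf.partialSups_le (h : MaxitiveLinf μ φ) {f : ℕ → X → ℝ}
    (hf : ∀ n, MemLinf μ (f n)) (n : ℕ) : φ (partialSups f n) ≤ ⨆ k, φ (f k) := by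
  induction n with
  | zero => simpa using le_iSup (fun k => φ (f k)) 0
  | succ n ih =>
    rw [partialSups_succ_eq_fun_max]
    exact (h _ _ (memLinf_partialSups hf n) (hf (n + 1))).trans
      (max_le ih (le_iSup (fun k => φ (f k)) (n + 1)))

theorem MaxitiveLinf.sigmaMaxitiveLinf (h : MaxitiveLinf μ φ) (hc : ContFromBelowLinf μ φ) :
    SigmaMaxitiveLinf μ φ := by
  intro f g hf hg hbdd hsup
  rw [← hc (fun n => partialSups f n) g (memLinf_partialSups hf) hg ?_ ?_]
  · exact iSup_le (h.partialSups_le hf)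
  · exact .of_forall fun x m n hmn => (partialSups f).monotone hmn x
  · filter_upwards [hbdd, hsup] with x hb hx
    have key : ∀ n, partialSups f n x = partialSups (fun k => f k x) n :=
      fun n => Pi.partialSups_apply f n x
    simp only [key]
    rw [hx, ← ciSup_partialSups_eq hb]
    exact tendsto_atTop_ciSup (partialSups _).monotone (bddAbove_range_partialSups.2 hb)

theorem SigmaMaxitiveLinf.maxitiveLinf (h : SigmaMaxitiveLinf μ φ) : MaxitiveLinf μ φ := by
  intro f g hf hg
  have hle : ∀ (x : X) (n : ℕ), (if n = 0 then f else g) x ≤ max (f x) (g x) := by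
    intro x n
    split_ifs <;> simp
  have hbdd : ∀ x, BddAbove (range fun n : ℕ => (if n = 0 then f else g) x) :=
    fun x => ⟨max (f x) (g x), forall_mem_range.2 (hle x)⟩
  refine (h (fun n => if n = 0 then f else g) _ ?_ (hf.max hg) (.of_forall hbdd)
    (.of_forall fun x => le_antisymm (max_le ?_ ?_) (ciSup_le (hle x)))).trans (iSup_le ?_)
  · intro n
    split_ifs <;> assumption
  · simpa using le_ciSup (hbdd x) 0
  · simpa using le_ciSup (hbdd x) 1
  · intro n
    split_ifs <;> simp

theorem SigmaMaxitiveLinf.contFromBelowLinf (h : SigmaMaxitiveLinf μ φ)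
    (hφ : IsMonetaryRiskMeasure μ φ) : ContFromBelowLinf μ φ := by
  intro f g hf hg hmono hlim
  have hle : ∀ᵐ x ∂μ, ∀ n, f n x ≤ g x := by
    filter_upwards [hmono, hlim] with x hm hl using hm.ge_of_tendsto hl
  refine le_antisymm (iSup_le fun n => hφ.2.1 _ _ (hf n).1 hg.1 (hle.mono fun x hx => hx n))
    (h f g hf hg (hle.mono fun x hx => ⟨g x, forall_mem_range.2 hx⟩) ?_)
  filter_upwards [hmono, hlim, hle] with x hm hl hx
  exact tendsto_nhds_unique hl (tendsto_atTop_ciSup hm ⟨g x, forall_mem_range.2 hx⟩)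

end

/-- A monetary risk measure is maxitive and continuous from below on `L^∞` iff it is
σ-maxitive on `L^∞`. -/
theorem maxitive_contFromBelow_iff_sigmaMaxitive
    (μ : Measure X) [IsProbabilityMeasure μ]
    (φ : (X → ℝ) → EReal) (hφ : IsMonetaryRiskMeasure μ φ) :
    (MaxitiveLinf μ φ ∧ ContFromBelowLinf μ φ) ↔ SigmaMaxitiveLinf μ φ :=
  ⟨fun h => h.1.sigmaMaxitiveLinf h.2, fun h => ⟨h.maxitiveLinf, h.contFromBelowLinf hφ⟩⟩
end
end

section
/- Let φ : L⁰ → [−∞,∞] be a monetary risk measure whose restriction to L^∞ is maxitive, and let I : X → [0,∞] be measurable. If the concentration of φ satisfies J_A = −ess.inf_A I for every A ∈ 𝒳, then φ(f) = ess.sup_X(f − I) for every f ∈ L^∞. -/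
open MeasureTheory Filter Set Topology ENNReal

noncomputable section

variable {X : Type*} [MeasurableSpace X]

/-- The concentration of `φ`: `J_A = inf_{r<0} φ (r · 1_{Aᶜ})`. -/
def conc (φ : (X → ℝ) → EReal) (A : Set X) : EReal :=
  ⨅ r : {r : ℝ // r < 0}, φ (Aᶜ.indicator fun _ => (r : ℝ))

namespace IsMonetaryRiskMeasure

variable {μ : Measure X} {φ : (X → ℝ) → EReal}

lemma map_const (hφ : IsMonetaryRiskMeasure μ φ) (c : ℝ) : φ (fun _ => c) = c := by
  have h := hφ.2.2 (fun _ => 0) measurable_const c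
  simpa [hφ.1] using h

/-- If `f ≥ c` on `A`, then `φ f ≥ J_A + c`. -/
lemma add_conc_le (hφ : IsMonetaryRiskMeasure μ φ) {f : X → ℝ} (hf : MemLinf μ f)
    {A : Set X} (hA : MeasurableSet A) {c : ℝ} (hc : ∀ x ∈ A, c ≤ f x) :
    conc φ A + (c : EReal) ≤ φ f := by
  obtain ⟨hfm, C, hC⟩ := hf
  have hr : min (-C - c) (-1) < 0 := (min_le_right _ _).trans_lt (by norm_num)
  have hind : Measurable (Aᶜ.indicator fun _ => min (-C - c) (-1)) :=
    measurable_const.indicator hA.compl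
  calc conc φ A + (c : EReal)
      ≤ φ (Aᶜ.indicator fun _ => min (-C - c) (-1)) + (c : EReal) :=
        add_le_add_left (iInf_le (fun r : {r : ℝ // r < 0} =>
          φ (Aᶜ.indicator fun _ => (r : ℝ))) ⟨_, hr⟩) _
    _ = φ (fun x => Aᶜ.indicator (fun _ => min (-C - c) (-1)) x + c) :=
        (hφ.2.2 _ hind c).symm
    _ ≤ φ f := by
        refine hφ.2.1 _ _ (hind.add_const c) hfm ?_
        filter_upwards [hC] with x hx
        by_cases hxA : x ∈ A
        · simpa [hxA] using hc x hxA
        · have h₁ := min_le_left (-C - c) (-1)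
          have h₂ := neg_le_of_abs_le hx
          simp only [indicator, mem_compl_iff, hxA, not_false_eq_true, if_true]
          linarith

/-- If `φ f < a`, then the set where `I < q` and `f > q + a` is null. -/
lemma measure_sublevel_inter_eq_zero (hφ : IsMonetaryRiskMeasure μ φ) {I : X → ℝ≥0∞}
    (hI : Measurable I)
    (hJ : ∀ A : Set X, MeasurableSet A →
      conc φ A = -(essInf (fun x => (I x : EReal)) (μ.restrict A)))
    {f : X → ℝ} (hf : MemLinf μ f) {a : ℝ} (ha : φ f < a) (q : ℝ) :
    μ {x | (I x : EReal) < q ∧ q + a < f x} = 0 := by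
  set A := {x | (I x : EReal) < q ∧ q + a < f x}
  have hA : MeasurableSet A :=
    (measurableSet_lt hI.coe_ereal_ennreal measurable_const).inter
      (measurableSet_lt measurable_const hf.1)
  by_contra hpos
  have hinf : essInf (fun x => (I x : EReal)) (μ.restrict A) ≤ q := by
    by_contra! hlt
    have h := (ae_restrict_iff' hA).1 (ae_lt_of_lt_essInf hlt)
    refine hpos (measure_mono_null (fun x hx => ?_) h)
    exact fun hx' => (hx' hx).not_gt hx.1
  have hle := hφ.add_conc_le hf hA (c := q + a) fun x hx => hx.2.le
  rw [hJ A hA] at hle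
  refine ha.not_ge (le_trans ?_ hle)
  calc (a : EReal) = -(q : EReal) + ((q + a : ℝ) : EReal) := by
        rw [← EReal.coe_neg, ← EReal.coe_add]; simp
    _ ≤ _ := add_le_add_left (EReal.neg_le_neg_iff.2 hinf) _

lemma essSup_sub_le (hφ : IsMonetaryRiskMeasure μ φ) {I : X → ℝ≥0∞} (hI : Measurable I)
    (hJ : ∀ A : Set X, MeasurableSet A →
      conc φ A = -(essInf (fun x => (I x : EReal)) (μ.restrict A)))
    {f : X → ℝ} (hf : MemLinf μ f) :
    essSup (fun x => (f x : EReal) - (I x : EReal)) μ ≤ φ f := by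
  rw [← EReal.le_of_forall_lt_iff_le]
  intro a ha
  refine essSup_le_of_ae_le _ ?_
  have hnull : ∀ᵐ x ∂μ, ∀ q : ℚ, ¬((I x : EReal) < (q : ℝ) ∧ (q : ℝ) + a < f x) :=
    ae_all_iff.2 fun q => by
      simpa [ae_iff] using hφ.measure_sublevel_inter_eq_zero hI hJ hf ha q
  filter_upwards [hnull] with x hx
  by_contra! hlt
  cases h : I x with
  | top => simp [h] at hlt
  | coe t =>
    rw [h, EReal.coe_nnreal_eq_coe_real, ← EReal.coe_sub, EReal.coe_lt_coe_iff] at hlt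
    obtain ⟨q, hq₁, hq₂⟩ := exists_rat_btwn (show (t : ℝ) < f x - a by linarith)
    refine hx q ⟨?_, by linarith⟩
    rw [h, EReal.coe_nnreal_eq_coe_real]
    exact_mod_cast hq₁

lemma map_min_le (hφ : IsMonetaryRiskMeasure μ φ) (hmax : MaxitiveLinf μ φ)
    {f : X → ℝ} (hf : MemLinf μ f) {b c d : ℝ} (hconc : conc φ {x | c ≤ f x} + (d : EReal) < b)
    (hb : φ (fun x => min (f x) c) ≤ b) : φ (fun x => min (f x) d) ≤ b := by
  obtain ⟨hfm, C, hC⟩ := hf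
  set A := {x | c ≤ f x}
  have hA : MeasurableSet A := measurableSet_le measurable_const hfm
  have hlt : conc φ A < ((b - d : ℝ) : EReal) := by
    rw [EReal.coe_sub]
    exact EReal.lt_sub_iff_add_lt (by simp) (by simp) |>.2 hconc
  obtain ⟨⟨r, hr⟩, hφr⟩ := iInf_lt_iff.1 hlt
  have hind : Measurable (Aᶜ.indicator fun _ => r) := measurable_const.indicator hA.compl
  have hm₁ : Measurable fun x => min (f x) c := hfm.min measurable_const
  have hm₂ : Measurable fun x => Aᶜ.indicator (fun _ => r) x + d := hind.add_const d
  have hb₁ : MemLinf μ fun x => min (f x) c := by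
    refine ⟨hm₁, C + |c|, ?_⟩
    filter_upwards [hC] with x hx
    rcases min_choice (f x) c with h | h <;> rw [h] <;>
      linarith [abs_nonneg c, abs_nonneg (f x)]
  have hb₂ : MemLinf μ fun x => Aᶜ.indicator (fun _ => r) x + d := by
    refine ⟨hm₂, |r| + |d|, Eventually.of_forall fun x => (abs_add_le _ _).trans ?_⟩
    by_cases hx : x ∈ A <;> simp [hx]
  calc φ (fun x => min (f x) d)
      ≤ φ (fun x => max (min (f x) c) (Aᶜ.indicator (fun _ => r) x + d)) := by
        refine hφ.2.1 _ _ (hfm.min measurable_const) (hm₁.max hm₂) (Eventually.of_forall ?_)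
        intro x
        by_cases hx : x ∈ A
        · simp [hx]
        · have hxc : f x ≤ c := (not_le.1 hx).le
          exact (min_le_left _ _).trans ((le_min le_rfl hxc).trans (le_max_left _ _))
    _ ≤ max (φ fun x => min (f x) c) (φ fun x => Aᶜ.indicator (fun _ => r) x + d) :=
        hmax _ _ hb₁ hb₂
    _ ≤ b := by
        refine max_le hb ?_
        rw [hφ.2.2 _ hind d]
        calc _ ≤ ((b - d : ℝ) : EReal) + (d : EReal) := add_le_add_left hφr.le _
          _ = b := by rw [← EReal.coe_add]; simp

lemma le_essSup_sub (hφ : IsMonetaryRiskMeasure μ φ) (hmax : MaxitiveLinf μ φ) {I : X → ℝ≥0∞}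
    (hJ : ∀ A : Set X, MeasurableSet A →
      conc φ A = -(essInf (fun x => (I x : EReal)) (μ.restrict A)))
    {f : X → ℝ} (hf : MemLinf μ f) :
    φ f ≤ essSup (fun x => (f x : EReal) - (I x : EReal)) μ := by
  rw [← EReal.le_of_forall_lt_iff_le]
  intro b hb
  obtain ⟨a, hSa, hab⟩ := EReal.lt_iff_exists_real_btwn.1 hb
  rw [EReal.coe_lt_coe_iff] at hab
  have hae := ae_lt_of_essSup_lt hSa
  have hconc (c : ℝ) : conc φ {x | c ≤ f x} ≤ ((a - c : ℝ) : EReal) := by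
    have hA : MeasurableSet {x | c ≤ f x} := measurableSet_le measurable_const hf.1
    rw [hJ _ hA, EReal.neg_le, ← EReal.coe_neg]
    refine le_essInf_of_ae_le _ ((ae_restrict_iff' hA).2 ?_)
    filter_upwards [hae] with x hx hxc
    cases h : I x with
    | top => simp
    | coe t =>
      rw [h, EReal.coe_nnreal_eq_coe_real, ← EReal.coe_sub, EReal.coe_lt_coe_iff] at hx
      rw [EReal.coe_nnreal_eq_coe_real, EReal.coe_le_coe_iff]
      have hxc' : c ≤ f x := hxc
      linarith
  set ε := (b - a) / 2 with hε
  have hstep (n : ℕ) : φ (fun x => min (f x) (b + n * ε)) ≤ b := by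
    induction n with
    | zero =>
      calc _ ≤ φ (fun _ => b) :=
            hφ.2.1 _ _ (hf.1.min measurable_const) measurable_const
              (Eventually.of_forall fun x => by simp)
        _ = b := hφ.map_const b
    | succ n ih =>
      refine hφ.map_min_le hmax hf ?_ ih
      refine (add_le_add_left (hconc _) _).trans_lt ?_
      rw [← EReal.coe_add, EReal.coe_lt_coe_iff]
      push_cast
      linarith
  obtain ⟨C, hC⟩ := hf.2
  obtain ⟨n, hn⟩ := exists_nat_gt ((C - b) / ε)
  rw [div_lt_iff₀ (by linarith)] at hn
  refine le_trans (hφ.2.1 _ _ hf.1 (hf.1.min measurable_const) ?_) (hstep n)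
  filter_upwards [hC] with x hx
  exact le_min le_rfl (by linarith [le_of_abs_le hx])

end IsMonetaryRiskMeasure

/-- If `φ` is a maxitive monetary risk measure on `L^∞` whose concentration satisfies
`J_A = - ess.inf_A I` for all measurable `A`, then `φ` is the penalized maximum loss
`f ↦ ess.sup_X (f - I)` on `L^∞`. -/
theorem maxitive_concentration_rep
    (μ : Measure X) [IsProbabilityMeasure μ]
    (φ : (X → ℝ) → EReal) (hφ : IsMonetaryRiskMeasure μ φ)
    (hmax : MaxitiveLinf μ φ)
    (I : X → ℝ≥0∞) (hI : Measurable I)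
    (hJ : ∀ A : Set X, MeasurableSet A →
      conc φ A = -(essInf (fun x => (I x : EReal)) (μ.restrict A))) :
    ∀ f : X → ℝ, MemLinf μ f →
      φ f = essSup (fun x => (f x : EReal) - (I x : EReal)) μ := by
  exact fun f hf => le_antisymm (hφ.le_essSup_sub hmax hJ hf) (hφ.essSup_sub_le hI hJ hf)
end
end

section
/- Let φ : L⁰ → [−∞,∞] be a monetary risk measure and I : X → [0,∞] a measurable function such that φ(f) = ess.sup_X(f − I) for every f ∈ L^∞. Then the concentration of φ satisfies J_A = −ess.inf_A I for every A ∈ 𝒳. -/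
open MeasureTheory Filter Set Topology ENNReal

noncomputable section

variable {X : Type*} [MeasurableSpace X]

/-- If a monetary risk measure `φ` is the penalized maximum loss `f ↦ ess.sup_X (f - I)` on
`L^∞`, then its concentration satisfies `J_A = - ess.inf_A I` for every measurable `A`. -/
theorem penalizedMaxLoss_concentration
    (μ : Measure X) [IsProbabilityMeasure μ]
    (φ : (X → ℝ) → EReal) (hφ : IsMonetaryRiskMeasure μ φ)
    (I : X → ℝ≥0∞) (hI : Measurable I)
    (hrep : ∀ f : X → ℝ, MemLinf μ f →
      φ f = essSup (fun x => (f x : EReal) - (I x : EReal)) μ) :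
    ∀ A : Set X, MeasurableSet A →
      conc φ A = -(essInf (fun x => (I x : EReal)) (μ.restrict A)) := by
  intro A hA
  have hmem (r : ℝ) : MemLinf μ (Aᶜ.indicator fun _ => r) := by
    refine ⟨measurable_const.indicator hA.compl, |r|, Eventually.of_forall fun x => ?_⟩
    by_cases hx : x ∈ A <;> simp [hx]
  apply le_antisymm
  · refine EReal.le_of_forall_lt_iff_le.mp fun c hc => ?_
    refine (iInf_le _ ⟨min c (-1), (min_le_right _ _).trans_lt (by norm_num)⟩).trans ?_
    rw [hrep _ (hmem _)]
    refine essSup_le_of_ae_le _ ?_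
    have hinf : ∀ᵐ x ∂μ.restrict A,
        essInf (fun x => (I x : EReal)) (μ.restrict A) ≤ (I x : EReal) := ae_essInf_le
    filter_upwards [(ae_restrict_iff' hA).mp hinf] with x hx
    by_cases hxA : x ∈ A
    · simpa [hxA] using (EReal.neg_le_neg_iff.mpr (hx hxA)).trans hc.le
    · have hle : ((min c (-1) : ℝ) : EReal) - (I x : EReal) ≤ ((min c (-1) : ℝ) : EReal) - 0 :=
        EReal.sub_le_sub le_rfl (EReal.coe_ennreal_nonneg _)
      rw [sub_zero] at hle
      simpa only [indicator_of_mem (mem_compl hxA)] using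
        hle.trans (EReal.coe_le_coe_iff.mpr (min_le_left _ _))
  · refine le_iInf fun r => ?_
    rw [hrep _ (hmem _), EReal.neg_le]
    refine le_essInf_of_ae_le _ ?_
    have hsup := ae_le_essSup (μ := μ)
      (f := fun x => ((Aᶜ.indicator (fun _ => (r : ℝ)) x : ℝ) : EReal) - (I x : EReal))
    filter_upwards [ae_restrict_of_ae hsup, ae_restrict_mem hA] with x hx hxA
    rw [EReal.neg_le]
    simpa [hxA] using hx
end
end

section
/- Let φ : L⁰ → [−∞,∞] be a monetary risk measure that is maxitive on all of L⁰, and let I : X → [0,∞] be measurable with φ(f) = ess.sup_X(f − I) for every f ∈ L^∞. Then φ(f) = ess.sup_X(f − I) for every f ∈ L^φ, where L^φ := { f ∈ L⁰ : φ(t f) < ∞ for some t > 1 }. -/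
open MeasureTheory Filter Set Topology ENNReal

noncomputable section

variable {X : Type*} [MeasurableSpace X]

/-- `φ` is maxitive on all of `L⁰`. -/
def MaxitiveL0 (φ : (X → ℝ) → EReal) : Prop :=
  ∀ f g : X → ℝ, Measurable f → Measurable g →
    φ (fun x => max (f x) (g x)) ≤ max (φ f) (φ g)

theorem EReal.le_of_eventually_le_max_coe {a b : EReal} {u : ℕ → ℝ}
    (hu : Tendsto u atTop atBot) (h : ∀ᶠ n in atTop, a ≤ max b (u n : EReal)) : a ≤ b := by
  have hlim : Tendsto (fun n => max b (u n : EReal)) atTop (𝓝 (max b ⊥)) :=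
    tendsto_const_nhds.max (EReal.tendsto_coe_nhds_bot_iff.2 hu)
  rw [max_bot_right] at hlim
  exact ge_of_tendsto hlim h

/-- Truncation of `f` to the interval `[-n, n]`. -/
def truncate (f : X → ℝ) (n : ℕ) (x : X) : ℝ := max (min (f x) n) (-n)

theorem memLinf_truncate (μ : Measure X) {f : X → ℝ} (hf : Measurable f) (n : ℕ) :
    MemLinf μ (truncate f n) := by
  refine ⟨(hf.min measurable_const).max measurable_const, n, Eventually.of_forall fun x => ?_⟩
  exact abs_le.2 ⟨le_max_right _ _,
    max_le (min_le_right _ _) (neg_le_self n.cast_nonneg)⟩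

theorem IsMonetaryRiskMeasure.apply_const {μ : Measure X} {φ : (X → ℝ) → EReal}
    (hφ : IsMonetaryRiskMeasure μ φ) (c : ℝ) : φ (fun _ => c) = c := by
  simpa [hφ.1] using hφ.2.2 (fun _ => 0) measurable_const c

theorem essSup_max_sub_le (μ : Measure X) (f g : X → ℝ) (I : X → ℝ≥0∞) :
    essSup (fun x => ((max (f x) (g x) : ℝ) : EReal) - (I x : EReal)) μ ≤
      max (essSup (fun x => (f x : EReal) - (I x : EReal)) μ)
        (essSup (fun x => (g x : EReal) - (I x : EReal)) μ) := by
  refine essSup_le_of_ae_le _ ?_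
  filter_upwards [ae_le_essSup (μ := μ) (f := fun x => (f x : EReal) - (I x : EReal)),
    ae_le_essSup (μ := μ) (f := fun x => (g x : EReal) - (I x : EReal))] with x hfx hgx
  rcases max_choice (f x) (g x) with h | h <;> rw [h]
  · exact hfx.trans (le_max_left _ _)
  · exact hgx.trans (le_max_right _ _)

/-- If a monetary risk measure `φ` is maxitive on all of `L⁰` and is the penalized maximum
loss `f ↦ ess.sup_X (f - I)` on `L^∞`, then the same representation holds for every
`f ∈ L^φ = {f ∈ L⁰ : φ(t f) < ∞ for some t > 1}`. -/
theorem penalizedMaxLoss_extends_to_Lphi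
    (μ : Measure X) [IsProbabilityMeasure μ]
    (φ : (X → ℝ) → EReal) (hφ : IsMonetaryRiskMeasure μ φ)
    (hmax : MaxitiveL0 φ)
    (I : X → ℝ≥0∞) (hI : Measurable I)
    (hrep : ∀ f : X → ℝ, MemLinf μ f →
      φ f = essSup (fun x => (f x : EReal) - (I x : EReal)) μ) :
    ∀ f : X → ℝ, Measurable f → (∃ t : ℝ, 1 < t ∧ φ (fun x => t * f x) < ⊤) →
      φ f = essSup (fun x => (f x : EReal) - (I x : EReal)) μ := by
  intro f hf ⟨t, ht, hK⟩
  have hneg : Tendsto (fun n : ℕ => -(n : ℝ)) atTop atBot :=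
    tendsto_neg_atTop_atBot.comp tendsto_natCast_atTop_atTop
  have hT (n : ℕ) := memLinf_truncate μ hf n
  apply le_antisymm
  · obtain ⟨k, hk, -⟩ := EReal.lt_iff_exists_real_btwn.1 hK
    have hlin : Tendsto (fun n : ℕ => k + (t - 1) * -(n : ℝ)) atTop atBot :=
      tendsto_atBot_add_const_left _ _ (hneg.const_mul_atBot (sub_pos.2 ht))
    have hmaxlim : Tendsto (fun n : ℕ => max (-(n : ℝ)) (k + (t - 1) * -(n : ℝ))) atTop atBot := by
      rw [tendsto_atBot]
      intro b
      filter_upwards [tendsto_atBot.1 hneg b, tendsto_atBot.1 hlin b] with n h₁ h₂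
      exact max_le h₁ h₂
    refine EReal.le_of_eventually_le_max_coe hmaxlim (Eventually.of_forall fun n => ?_)
    have htf : Measurable fun x => t * f x := hf.const_mul t
    have htail : φ (fun x => t * f x + (t - 1) * -(n : ℝ)) ≤
        ((k + (t - 1) * -(n : ℝ) : ℝ) : EReal) := by
      rw [hφ.2.2 _ htf, EReal.coe_add]
      gcongr
    have htrunc : φ (truncate f n) ≤
        max (essSup (fun x => (f x : EReal) - (I x : EReal)) μ) ((-(n : ℝ) : ℝ) : EReal) := by
      rw [hrep _ (hT n)]
      refine (essSup_max_sub_le μ (fun x => min (f x) n) (fun _ => -(n : ℝ)) I).trans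
        (max_le_max (essSup_mono_ae (Eventually.of_forall fun x => ?_)) ?_)
      · exact EReal.sub_le_sub (EReal.coe_le_coe (min_le_left _ _)) le_rfl
      · rw [← hrep _ ⟨measurable_const, |-(n : ℝ)|, Eventually.of_forall fun _ => le_rfl⟩,
          hφ.apply_const]
    have hsplit : φ f ≤ max (φ (truncate f n)) (φ fun x => t * f x + (t - 1) * -(n : ℝ)) := by
      refine (hφ.2.1 _ _ hf ((hT n).1.max (htf.add_const _))
        (Eventually.of_forall fun x => ?_)).trans (hmax _ _ (hT n).1 (htf.add_const _))
      rcases le_total (f x) n with h | h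
      · exact le_max_of_le_left (le_max_of_le_left (le_min le_rfl h))
      · exact le_max_of_le_right (by nlinarith)
    refine (hsplit.trans (max_le_max htrunc htail)).trans ?_
    rw [EReal.coe_strictMono.monotone.map_max, max_assoc]
  · have hbound (n : ℕ) : essSup (fun x => (truncate f n x : EReal) - (I x : EReal)) μ ≤
        max (φ f) ((-(n : ℝ) : ℝ) : EReal) := by
      rw [← hrep _ (hT n), ← hφ.apply_const (-(n : ℝ))]
      refine (hφ.2.1 _ _ (hT n).1 (hf.max measurable_const)
        (Eventually.of_forall fun x => ?_)).trans (hmax _ _ hf measurable_const)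
      exact max_le_max (min_le_left _ _) le_rfl
    refine essSup_le_of_ae_le _ ?_
    filter_upwards [ae_all_iff.2 fun n : ℕ => ae_le_essSup (μ := μ)
      (f := fun x => (truncate f n x : EReal) - (I x : EReal))] with x hx
    refine EReal.le_of_eventually_le_max_coe hneg ?_
    obtain ⟨N, hN⟩ := exists_nat_ge |f x|
    filter_upwards [eventually_ge_atTop N] with n hn
    have habs := abs_le.1 (hN.trans (Nat.cast_le.2 hn))
    have heq : truncate f n x = f x := by
      rw [truncate, min_eq_left habs.2, max_eq_left habs.1]
    simpa only [heq] using (hx n).trans (hbound n)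
end
end

section
/- Let I, I' : X → [0,∞] be measurable functions on a probability space (X, 𝒳, μ) such that ess.sup_X(f − I) = ess.sup_X(f − I') for every bounded measurable f : X → ℝ. Then I = I' μ-almost surely. -/
open MeasureTheory Filter Set Topology ENNReal

noncomputable section

/-- A penalty whose penalized maximum loss dominates that of another penalty on bounded measurable
functions lies almost surely below it. -/
theorem penalty_ae_le_of_essSup_le {X : Type*} [MeasurableSpace X] {μ : Measure X}
    {I I' : X → ℝ≥0∞} (hI : Measurable I)
    (h : ∀ f : X → ℝ, Measurable f → (∃ C : ℝ, ∀ x, |f x| ≤ C) →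
      essSup (fun x => (f x : EReal) - (I' x : EReal)) μ
        ≤ essSup (fun x => (f x : EReal) - (I x : EReal)) μ) :
    I ≤ᵐ[μ] I' := by
  classical
  have key (q : ℚ) (hq : 0 ≤ q) :
      ∀ᵐ x ∂μ, ENNReal.ofReal q ≤ I x → ENNReal.ofReal q ≤ I' x := by
    have hq' : (0 : ℝ) ≤ q := by exact_mod_cast hq
    have hcoe : ((ENNReal.ofReal q : ℝ≥0∞) : EReal) = ((q : ℝ) : EReal) := by
      rw [EReal.coe_ennreal_ofReal, max_eq_left hq']
    let f : X → ℝ := fun x => if ENNReal.ofReal q ≤ I x then 0 else -(q : ℝ)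
    have hf : Measurable f :=
      Measurable.ite (measurableSet_le measurable_const hI) measurable_const measurable_const
    have hle : essSup (fun x => (f x : EReal) - (I x : EReal)) μ ≤ -((q : ℝ) : EReal) := by
      refine essSup_le_of_ae_le _ (Eventually.of_forall fun x => ?_)
      by_cases hx : ENNReal.ofReal q ≤ I x
      · simp only [f, if_pos hx, EReal.coe_zero, zero_sub, EReal.neg_le_neg_iff, ← hcoe]
        exact_mod_cast hx
      · simp only [f, if_neg hx, EReal.coe_neg]
        exact EReal.sub_le_of_le_add' (le_add_of_nonneg_left (EReal.coe_ennreal_nonneg _))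
    filter_upwards [ae_le_essSup (μ := μ) (f := fun x => (f x : EReal) - (I' x : EReal))]
      with x hx hqx
    have hx' := hx.trans ((h f hf ⟨q, fun y => ?_⟩).trans hle)
    · simp only [f, if_pos hqx, EReal.coe_zero, zero_sub, EReal.neg_le_neg_iff, ← hcoe] at hx'
      exact_mod_cast hx'
    · by_cases hy : ENNReal.ofReal q ≤ I y
      · simpa [f, hy] using hq'
      · simp [f, hy, abs_of_nonneg hq']
  have hall : ∀ᵐ x ∂μ, ∀ q : ℚ, 0 ≤ q → ENNReal.ofReal q ≤ I x → ENNReal.ofReal q ≤ I' x := by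
    rw [ae_all_iff]
    intro q
    by_cases hq : 0 ≤ q
    · filter_upwards [key q hq] with x hx _ using hx
    · exact Eventually.of_forall fun _ hq' => absurd hq' hq
  filter_upwards [hall] with x hx
  by_contra! hlt
  obtain ⟨q, hq, h₁, h₂⟩ := ENNReal.lt_iff_exists_rat_btwn.1 hlt
  exact h₁.not_ge (hx q hq h₂.le)

/-- If two measurable penalties `I, I' : X → [0,∞]` induce the same penalized maximum loss
`ML_I (f) = ess.sup_X (f - I)` for every bounded measurable `f : X → ℝ`, then `I = I'`
μ-almost surely. -/
theorem penalty_ae_unique {X : Type*} [MeasurableSpace X]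
    (μ : Measure X) [IsProbabilityMeasure μ]
    (I I' : X → ℝ≥0∞) (hI : Measurable I) (hI' : Measurable I')
    (h : ∀ f : X → ℝ, Measurable f → (∃ C : ℝ, ∀ x, |f x| ≤ C) →
      essSup (fun x => (f x : EReal) - (I x : EReal)) μ
        = essSup (fun x => (f x : EReal) - (I' x : EReal)) μ) :
    I =ᵐ[μ] I' :=
  (penalty_ae_le_of_essSup_le hI fun f hf hb => (h f hf hb).ge).antisymm
    (penalty_ae_le_of_essSup_le hI' fun f hf hb => (h f hf hb).le)
end
end

section
/- Let (X, 𝒳, μ) be a probability space with μ atomless and L²(X, 𝒳, μ) separable, and let φ : L⁰ → [−∞,∞] be a monetary risk measure whose restriction to L^∞ is maxitive and law-invariant, i.e. φ(f) = φ(g) whenever f, g ∈ L^∞ satisfy μ(f ≤ x) = μ(g ≤ x) for all x ∈ ℝ. Then φ(f) = ess.sup_X f for every f ∈ L^∞. -/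
open MeasureTheory Filter Set Topology ENNReal

noncomputable section

variable {X : Type*} [MeasurableSpace X]

/-- `μ` is atomless: every set of positive measure contains a measurable subset of strictly
smaller positive measure. -/
def AtomlessMeasure (μ : Measure X) : Prop :=
  ∀ A : Set X, MeasurableSet A → 0 < μ A →
    ∃ B, B ⊆ A ∧ MeasurableSet B ∧ 0 < μ B ∧ μ B < μ A

/-- An atomless finite measure has measurable sets of arbitrarily small positive measure inside
every measurable set of positive measure. -/
lemma AtomlessMeasure.exists_subset_measureReal_le {μ : Measure X} [IsFiniteMeasure μ]
    (h : AtomlessMeasure μ) {A : Set X} (hA : MeasurableSet A) (hpos : 0 < μ.real A)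
    {ε : ℝ} (hε : 0 < ε) :
    ∃ E ⊆ A, MeasurableSet E ∧ 0 < μ.real E ∧ μ.real E ≤ ε := by
  have halve : ∀ n : ℕ, ∃ E ⊆ A, MeasurableSet E ∧ 0 < μ.real E ∧
      μ.real E ≤ μ.real A * (1 / 2) ^ n := by
    intro n
    induction n with
    | zero => exact ⟨A, Subset.rfl, hA, hpos, by simp⟩
    | succ n ih =>
      obtain ⟨E, hEA, hE, hE0, hEn⟩ := ih
      obtain ⟨B, hBE, hB, hB0, hBlt⟩ := h E hE (ENNReal.toReal_pos_iff.1 hE0).1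
      have hB0' : 0 < μ.real B := ENNReal.toReal_pos hB0.ne' (measure_ne_top μ B)
      have hBlt' : μ.real B < μ.real E :=
        (ENNReal.toReal_lt_toReal (measure_ne_top μ B) (measure_ne_top μ E)).2 hBlt
      have hdiff : μ.real (E \ B) = μ.real E - μ.real B := measureReal_sdiff hBE hB
      rw [pow_succ]
      rcases le_total (μ.real B) (μ.real E / 2) with hle | hle
      · exact ⟨B, hBE.trans hEA, hB, hB0', by linarith⟩
      · exact ⟨E \ B, sdiff_subset.trans hEA, hE.diff hB, by linarith, by linarith⟩
  have hlim : Tendsto (fun n : ℕ => μ.real A * (1 / 2 : ℝ) ^ n) atTop (𝓝 (μ.real A * 0)) :=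
    (_root_.tendsto_pow_atTop_nhds_zero_of_lt_one (by norm_num) (by norm_num)).const_mul _
  rw [mul_zero] at hlim
  obtain ⟨n, hn⟩ := (hlim.eventually_lt_const hε).exists
  obtain ⟨E, hEA, hE, hE0, hEn⟩ := halve n
  exact ⟨E, hEA, hE, hE0, hEn.trans hn.le⟩

/-- Among the measurable subsets of `A` of measure at most `c` there is one which is not contained
in another such set of larger measure. -/
lemma exists_maximal_measureReal_le (μ : Measure X) [IsFiniteMeasure μ] (A : Set X)
    {c : ℝ} (hc : 0 ≤ c) :
    ∃ U ⊆ A, MeasurableSet U ∧ μ.real U ≤ c ∧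
      ∀ C ⊆ A, MeasurableSet C → μ.real C ≤ c → U ⊆ C → μ.real C ≤ μ.real U := by
  let T := {B : Set X // B ⊆ A ∧ MeasurableSet B ∧ μ.real B ≤ c}
  have step : ∀ B : T, ∃ B' : T, B.1 ⊆ B'.1 ∧
      ∀ C : T, B.1 ⊆ C.1 → μ.real B.1 + μ.real C.1 ≤ 2 * μ.real B'.1 := by
    intro B
    let R : Set ℝ := {r | ∃ C : T, B.1 ⊆ C.1 ∧ r = μ.real C.1}
    have hbdd : BddAbove R := ⟨c, by rintro r ⟨C, -, rfl⟩; exact C.2.2.2⟩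
    have hBR : μ.real B.1 ∈ R := ⟨B, Subset.rfl, rfl⟩
    rcases (le_csSup hbdd hBR).eq_or_lt with heq | hlt
    · refine ⟨B, Subset.rfl, fun C hC => ?_⟩
      have := le_csSup hbdd (show μ.real C.1 ∈ R from ⟨C, hC, rfl⟩)
      linarith
    · obtain ⟨r, ⟨B', hBB', rfl⟩, hr⟩ := exists_lt_of_lt_csSup ⟨_, hBR⟩
        (show (μ.real B.1 + sSup R) / 2 < sSup R by linarith)
      refine ⟨B', hBB', fun C hC => ?_⟩
      have := le_csSup hbdd (show μ.real C.1 ∈ R from ⟨C, hC, rfl⟩)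
      linarith
  choose next hsub hnext using step
  let B : ℕ → T := fun n => next^[n] ⟨∅, empty_subset A, MeasurableSet.empty, by simpa using hc⟩
  have hB : ∀ n, B (n + 1) = next (B n) := fun n => Function.iterate_succ_apply' _ _ _
  have hmono : Monotone fun n => (B n).1 :=
    monotone_nat_of_le_succ fun n => by rw [hB]; exact hsub _
  have hlim : Tendsto (fun n => μ.real (B n).1) atTop (𝓝 (μ.real (⋃ n, (B n).1))) :=
    (ENNReal.tendsto_toReal (measure_ne_top μ _)).comp (tendsto_measure_iUnion_atTop hmono)
  refine ⟨⋃ n, (B n).1, iUnion_subset fun n => (B n).2.1,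
    MeasurableSet.iUnion fun n => (B n).2.2.1,
    le_of_tendsto' hlim fun n => (B n).2.2.2, fun C hCA hC hCc hUC => ?_⟩
  have hle : ∀ n, μ.real (B n).1 + μ.real C ≤ 2 * μ.real (B (n + 1)).1 := fun n => by
    rw [hB]
    exact hnext (B n) ⟨C, hCA, hC, hCc⟩ ((subset_iUnion (fun n => (B n).1) n).trans hUC)
  have := le_of_tendsto_of_tendsto' (hlim.add_const (μ.real C))
    (((tendsto_add_atTop_iff_nat 1).2 hlim).const_mul 2) hle
  linarith

/-- Sierpiński's theorem: an atomless finite measure takes all intermediate values. -/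
lemma AtomlessMeasure.exists_subset_measureReal_eq {μ : Measure X} [IsFiniteMeasure μ]
    (h : AtomlessMeasure μ) {A : Set X} (hA : MeasurableSet A) {c : ℝ} (hc : 0 ≤ c)
    (hcA : c ≤ μ.real A) :
    ∃ B ⊆ A, MeasurableSet B ∧ μ.real B = c := by
  obtain ⟨U, hUA, hU, hUc, hmax⟩ := exists_maximal_measureReal_le μ A hc
  refine ⟨U, hUA, hU, hUc.antisymm ?_⟩
  by_contra! hlt
  have hdiff : μ.real (A \ U) = μ.real A - μ.real U := measureReal_sdiff hUA hU
  obtain ⟨E, hEA, hE, hE0, hEc⟩ := h.exists_subset_measureReal_le (hA.diff hU)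
    (by linarith) (sub_pos.2 hlt)
  have hUE : μ.real (U ∪ E) = μ.real U + μ.real E :=
    measureReal_union (disjoint_sdiff_right.mono_right hEA) hE
  have := hmax (U ∪ E) (union_subset hUA (hEA.trans sdiff_subset)) (hU.union hE)
    (by linarith) subset_union_left
  linarith

lemma memLinf_indicator_const (μ : Measure X) {S : Set X} (hS : MeasurableSet S) (a : ℝ) :
    MemLinf μ (S.indicator fun _ => a) := by
  refine ⟨measurable_const.indicator hS, |a|, ae_of_all _ fun x => ?_⟩
  by_cases hx : x ∈ S <;> simp [hx]

/-- Indicators of sets of equal measure have the same law. -/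
lemma measure_indicator_const_le_congr {μ : Measure X} {S T : Set X} (a : ℝ)
    (h : μ S = μ T) (hc : μ Sᶜ = μ Tᶜ) (x : ℝ) :
    μ {y | S.indicator (fun _ => a) y ≤ x} = μ {y | T.indicator (fun _ => a) y ≤ x} := by
  have key : ∀ R : Set X, {y | R.indicator (fun _ => a) y ≤ x} =
      {y | (y ∈ R → a ≤ x) ∧ (y ∉ R → 0 ≤ x)} := by
    intro R
    ext y
    by_cases hy : y ∈ R <;> simp [hy]
  rw [key, key]
  by_cases ha : a ≤ x <;> by_cases h0 : 0 ≤ x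
  · simp [ha, h0]
  · simpa [ha, h0] using h
  · simpa [ha, h0, compl_def] using hc
  · simp [ha, h0]

/-- A set whose measure is a multiple of `μ A` splits into sets of measure `μ A`, so by maxitivity
and law-invariance penalising its complement is at most as risky as penalising that of `A`. -/
lemma le_of_measureReal_eq_nat_mul {μ : Measure X} [IsProbabilityMeasure μ]
    (hatomless : AtomlessMeasure μ) {φ : (X → ℝ) → EReal} (hφ : IsMonetaryRiskMeasure μ φ)
    (hmax : MaxitiveLinf μ φ)
    (hlaw : ∀ f g : X → ℝ, MemLinf μ f → MemLinf μ g →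
      (∀ x : ℝ, μ {a | f a ≤ x} = μ {a | g a ≤ x}) → φ f = φ g)
    {a : ℝ} (ha : a ≤ 0) {A : Set X} (hA : MeasurableSet A) (n : ℕ) :
    ∀ S : Set X, MeasurableSet S → μ.real S = n * μ.real A →
      φ (Sᶜ.indicator fun _ => a) ≤ φ (Aᶜ.indicator fun _ => a) := by
  induction n with
  | zero =>
    intro S hS hS0
    have hnull : μ S = 0 := (measureReal_eq_zero_iff).1 (by simpa using hS0)
    refine hφ.2.1 _ _ (measurable_const.indicator hS.compl) (measurable_const.indicator hA.compl) ?_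
    filter_upwards [measure_eq_zero_iff_ae_notMem.1 hnull] with x hx
    by_cases hxA : x ∈ A <;> simp [hx, hxA, ha]
  | succ n ih =>
    intro S hS hSn
    push_cast at hSn
    have hA0 : 0 ≤ μ.real A := measureReal_nonneg
    have hn0 : 0 ≤ n * μ.real A := by positivity
    obtain ⟨B, hBS, hB, hBA⟩ := hatomless.exists_subset_measureReal_eq hS hA0 (by linarith)
    have hdiff : μ.real (S \ B) = n * μ.real A := by
      rw [measureReal_sdiff hBS hB]; linarith
    have hBA' : μ B = μ A := (measureReal_eq_measureReal_iff).1 hBA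
    have hcompl : μ Bᶜ = μ Aᶜ := by
      rw [prob_compl_eq_one_sub hB, prob_compl_eq_one_sub hA, hBA']
    have hBφ : φ (Bᶜ.indicator fun _ => a) = φ (Aᶜ.indicator fun _ => a) :=
      hlaw _ _ (memLinf_indicator_const μ hB.compl a) (memLinf_indicator_const μ hA.compl a)
        (measure_indicator_const_le_congr a hcompl (by simpa using hBA'))
    have hsplit : (Sᶜ.indicator fun _ => a) =
        fun x => max (Bᶜ.indicator (fun _ => a) x) ((S \ B)ᶜ.indicator (fun _ => a) x) := by
      ext x
      by_cases hxB : x ∈ B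
      · have hxS := hBS hxB
        simp [hxB, hxS, ha]
      · by_cases hxS : x ∈ S <;> simp [hxB, hxS, ha]
    rw [hsplit]
    exact (hmax _ _ (memLinf_indicator_const μ hB.compl a)
      (memLinf_indicator_const μ (hS.diff hB).compl a)).trans
      (max_le hBφ.le (ih _ (hS.diff hB) hdiff))

/-- If `μ` is atomless, `L²(μ)` is separable, and the monetary risk measure `φ` is maxitive
and law-invariant on `L^∞`, then `φ` is the maximum loss `f ↦ ess.sup_X f` on `L^∞`. -/
theorem maxitive_lawInvariant_eq_maximumLoss
    (μ : Measure X) [IsProbabilityMeasure μ]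
    (hatomless : AtomlessMeasure μ)
    (hsep : TopologicalSpace.SeparableSpace (Lp ℝ 2 μ))
    (φ : (X → ℝ) → EReal) (hφ : IsMonetaryRiskMeasure μ φ)
    (hmax : MaxitiveLinf μ φ)
    (hlaw : ∀ f g : X → ℝ, MemLinf μ f → MemLinf μ g →
      (∀ x : ℝ, μ {a | f a ≤ x} = μ {a | g a ≤ x}) → φ f = φ g) :
    ∀ f : X → ℝ, MemLinf μ f → φ f = essSup (fun x => (f x : EReal)) μ := by
  intro f hf
  obtain ⟨hfm, C, hC⟩ := hf
  refine le_antisymm ?_ ?_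
  · by_contra! hlt
    obtain ⟨r, hr, hrφ⟩ := EReal.lt_iff_exists_real_btwn.1 hlt
    have hfr : ∀ᵐ x ∂μ, f x ≤ 0 + r := by
      filter_upwards [ae_lt_of_essSup_lt hr] with x hx
      rw [zero_add]
      exact (EReal.coe_lt_coe_iff.1 hx).le
    have h1 := hφ.2.1 f (fun _ => 0 + r) hfm measurable_const hfr
    have h2 : φ (fun _ => (0 : ℝ) + r) = 0 + (r : EReal) := by
      rw [hφ.2.2 (fun _ => 0) measurable_const r, hφ.1]
    rw [h2, zero_add] at h1
    exact absurd h1 hrφ.not_ge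
  · by_contra! hlt
    obtain ⟨s, hφs, hs⟩ := EReal.lt_iff_exists_real_btwn.1 hlt
    have hA : MeasurableSet {x | s < f x} := measurableSet_lt measurable_const hfm
    have hApos : 0 < μ.real {x | s < f x} := by
      refine ENNReal.toReal_pos (fun h0 => hs.not_ge (essSup_le_of_ae_le _ ?_)) (measure_ne_top μ _)
      filter_upwards [measure_eq_zero_iff_ae_notMem.1 h0] with x hx
      exact EReal.coe_le_coe_iff.2 (not_lt.1 hx)
    obtain ⟨n, hn⟩ := exists_nat_one_div_lt hApos
    obtain ⟨B, hBA, hB, hBn⟩ := hatomless.exists_subset_measureReal_eq hA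
      (c := 1 / ((n : ℝ) + 1)) (by positivity) hn.le
    have ha : -(|C| + |s|) ≤ 0 := neg_nonpos.2 (by positivity)
    have hBφ := le_of_measureReal_eq_nat_mul hatomless hφ hmax hlaw ha hB (n + 1) univ
      MeasurableSet.univ (by rw [hBn]; push_cast; simp; field_simp)
    simp only [compl_univ, indicator_empty] at hBφ
    rw [hφ.1] at hBφ
    have hBm : Measurable (Bᶜ.indicator fun _ : X => -(|C| + |s|)) :=
      measurable_const.indicator hB.compl
    have hle : ∀ᵐ x ∂μ, Bᶜ.indicator (fun _ => -(|C| + |s|)) x + s ≤ f x := by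
      filter_upwards [hC] with x hx
      by_cases hxB : x ∈ B
      · have : s < f x := hBA hxB
        simpa [hxB] using this.le
      · simp only [mem_compl_iff, hxB, not_false_eq_true, indicator_of_mem]
        linarith [neg_le_of_abs_le hx, le_abs_self C, le_abs_self s]
    have h1 := hφ.2.1 _ f (hBm.add_const s) hfm hle
    rw [hφ.2.2 _ hBm s] at h1
    have h2 : (s : EReal) ≤ φ (Bᶜ.indicator fun _ => -(|C| + |s|)) + s := by
      simpa using add_le_add_left hBφ (s : EReal)
    exact absurd (h2.trans h1) hφs.not_ge
end
end

section
/- Let φ : L⁰ → [−∞,∞] be a monetary risk measure. The following are equivalent: (1) φ is maxitive on L⁰ and continuous from below on L⁰; (2) φ is σ-maxitive on L⁰, i.e. φ(sup_{n∈ℕ} f_n) ≤ sup_{n∈ℕ} φ(f_n) for every sequence (f_n) in L⁰ whose pointwise supremum lies in L⁰ (is finite μ-a.s.); (3) there exists a measurable I : X → [0,∞] such that φ(f) = ess.sup_X(f − I) for every f ∈ L⁰. Moreover, in that case I is μ-a.s. unique. -/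
open MeasureTheory Filter Set Topology ENNReal

noncomputable section

variable {X : Type*} [MeasurableSpace X]

/-- `φ` is continuous from below on `L⁰`: `f n ↑ g` μ-a.s. implies `φ (f n) ↑ φ g`. -/
def ContFromBelowL0 (μ : Measure X) (φ : (X → ℝ) → EReal) : Prop :=
  ∀ (f : ℕ → X → ℝ) (g : X → ℝ), (∀ n, Measurable (f n)) → Measurable g →
    (∀ᵐ x ∂μ, Monotone fun n => f n x) →
    (∀ᵐ x ∂μ, Tendsto (fun n => f n x) atTop (𝓝 (g x))) →
    (⨆ n, φ (f n)) = φ g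

/-- `φ` is σ-maxitive on `L⁰`: for every sequence `(f n)` of measurable functions whose
pointwise supremum is μ-a.s. finite (hence defines an element `g` of `L⁰`), one has
`φ g ≤ ⨆ n, φ (f n)`. -/
def SigmaMaxitiveL0 (μ : Measure X) (φ : (X → ℝ) → EReal) : Prop :=
  ∀ (f : ℕ → X → ℝ) (g : X → ℝ), (∀ n, Measurable (f n)) → Measurable g →
    (∀ᵐ x ∂μ, BddAbove (range fun n => f n x)) →
    (∀ᵐ x ∂μ, g x = ⨆ n, f n x) →
    φ g ≤ ⨆ n, φ (f n)

/-- Every family of measurable functions has a countable subfamily whose pointwise supremum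
dominates every member almost everywhere. -/
lemma exists_seq_forall_ae_le_iSup (μ : Measure X) [IsFiniteMeasure μ]
    (A : Set (X → ℝ≥0∞)) (hA : ∀ f ∈ A, Measurable f) (hne : A.Nonempty) :
    ∃ h : ℕ → X → ℝ≥0∞, (∀ n, h n ∈ A) ∧ ∀ f ∈ A, ∀ᵐ x ∂μ, f x ≤ ⨆ n, h n x := by
  let F : ℝ≥0∞ → ℝ≥0∞ := fun t => (t⁻¹ + 1)⁻¹
  have hFmono : Monotone F := fun a b hab => by
    simp only [F]; gcongr
  have hFinj : Function.Injective F := fun a b hab => by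
    have h1 : a⁻¹ + 1 = b⁻¹ + 1 := inv_injective hab
    exact inv_injective ((ENNReal.add_left_inj one_ne_top).1 h1)
  have hFle : ∀ t, F t ≤ 1 := fun t => ENNReal.inv_le_one.2 le_add_self
  let J : (ℕ → X → ℝ≥0∞) → ℝ≥0∞ := fun h => ∫⁻ x, F (⨆ n, h n x) ∂μ
  let H : Set (ℕ → X → ℝ≥0∞) := {h | ∀ n, h n ∈ A}
  obtain ⟨a, ha⟩ := hne
  have hH : (J '' H).Nonempty := ⟨_, mem_image_of_mem J (show (fun _ => a) ∈ H from fun _ => ha)⟩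
  obtain ⟨u, -, hu, huH⟩ := exists_seq_tendsto_sSup hH (OrderTop.bddAbove _)
  choose k hkH hkJ using huH
  let h : ℕ → X → ℝ≥0∞ := fun n => k n.unpair.1 n.unpair.2
  have hhA : ∀ n, h n ∈ A := fun n => hkH _ _
  have hsup : sSup (J '' H) ≤ J h := by
    refine le_of_tendsto' hu fun n => ?_
    rw [← hkJ n]
    refine lintegral_mono fun x => hFmono (iSup_le fun m => ?_)
    refine le_iSup_of_le (Nat.pair n m) ?_
    simp [h]
  refine ⟨h, hhA, fun f hf => ?_⟩
  let h' : ℕ → X → ℝ≥0∞ := fun n => Nat.casesOn n f h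
  have hh'A : ∀ n, h' n ∈ A := fun n => by
    cases n with
    | zero => exact hf
    | succ n => exact hhA n
  have hle : ∀ x, ⨆ n, h n x ≤ ⨆ n, h' n x := fun x =>
    iSup_le fun n => le_iSup (fun n => h' n x) (n + 1)
  have hFm : Measurable F := hFmono.measurable
  have hJ' : J h' ≤ J h := (le_sSup (mem_image_of_mem J (show h' ∈ H from hh'A))).trans hsup
  have hfin : J h ≠ ∞ := by
    refine ne_top_of_le_ne_top (b := ∫⁻ _, 1 ∂μ) (by simp) (lintegral_mono fun x => hFle _)
  have hae := ae_eq_of_ae_le_of_lintegral_le (Eventually.of_forall fun x => hFmono (hle x)) hfin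
    (hFm.comp (Measurable.iSup fun n => hA _ (hh'A n))).aemeasurable hJ'
  filter_upwards [hae] with x hx
  rw [hFinj hx]
  exact le_iSup (fun n => h' n x) 0

lemma EReal.coe_sub_coe_ennreal_le_iff (a c : ℝ) (i : ℝ≥0∞) :
    (a : EReal) - (i : EReal) ≤ c ↔ ENNReal.ofReal (a - c) ≤ i := by
  induction i with
  | top => simp
  | coe r =>
    rw [ENNReal.ofReal_le_coe, EReal.coe_nnreal_eq_coe_real, ← EReal.coe_sub, EReal.coe_le_coe_iff]
    constructor <;> intro h <;> linarith

lemma essSup_coe_sub_le_iff (μ : Measure X) (f : X → ℝ) (I : X → ℝ≥0∞) (c : ℝ) :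
    essSup (fun x => (f x : EReal) - (I x : EReal)) μ ≤ c ↔
      ∀ᵐ x ∂μ, ENNReal.ofReal (f x - c) ≤ I x := by
  simp_rw [← EReal.coe_sub_coe_ennreal_le_iff]
  constructor
  · intro h
    filter_upwards [_root_.ae_le_essSup (f := fun x => (f x : EReal) - (I x : EReal)) (μ := μ)] with x hx
    exact hx.trans h
  · exact fun h => essSup_le_of_ae_le _ h

lemma EReal.eq_of_forall_le_coe_iff {a b : EReal} (h : ∀ c : ℝ, a ≤ c ↔ b ≤ c) : a = b :=
  le_antisymm
    (EReal.le_of_forall_lt_iff_le.1 fun c hc => (h c).2 hc.le)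
    (EReal.le_of_forall_lt_iff_le.1 fun c hc => (h c).1 hc.le)

lemma IsMonetaryRiskMeasure.le_coe_iff {μ : Measure X} {φ : (X → ℝ) → EReal}
    (hφ : IsMonetaryRiskMeasure μ φ) {f : X → ℝ} (hf : Measurable f) (c : ℝ) :
    φ f ≤ c ↔ φ (fun x => f x - c) ≤ 0 := by
  have h := hφ.2.2 f hf (-c)
  simp_rw [← sub_eq_add_neg] at h
  rw [h]
  induction φ f with
  | bot => simp
  | top => simp
  | coe r =>
    rw [← EReal.coe_add, ← EReal.coe_zero, EReal.coe_le_coe_iff, EReal.coe_le_coe_iff]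
    constructor <;> intro h <;> linarith

lemma SigmaMaxitiveL0.maxitiveL0 {μ : Measure X} {φ : (X → ℝ) → EReal}
    (h : SigmaMaxitiveL0 μ φ) : MaxitiveL0 φ := by
  intro f g hf hg
  let u : ℕ → X → ℝ := fun n => Nat.casesOn n f fun _ => g
  have hub : ∀ x n, u n x ≤ max (f x) (g x) := fun x n => by
    cases n with
    | zero => exact le_max_left _ _
    | succ n => exact le_max_right _ _
  have hbdd : ∀ x, BddAbove (range fun n => u n x) := fun x =>
    ⟨max (f x) (g x), forall_mem_range.2 (hub x)⟩
  refine (h u _ (fun n => ?_) (hf.max hg) (Eventually.of_forall hbdd)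
    (Eventually.of_forall fun x => ?_)).trans (iSup_le fun n => ?_)
  · cases n with
    | zero => exact hf
    | succ n => exact hg
  · exact le_antisymm (max_le (le_ciSup (hbdd x) 0) (le_ciSup (hbdd x) 1)) (ciSup_le (hub x))
  · cases n with
    | zero => exact le_max_left _ _
    | succ n => exact le_max_right _ _

lemma SigmaMaxitiveL0.contFromBelowL0 {μ : Measure X} {φ : (X → ℝ) → EReal}
    (hφ : IsMonetaryRiskMeasure μ φ) (h : SigmaMaxitiveL0 μ φ) : ContFromBelowL0 μ φ := by
  intro f g hf hg hmono hlim
  have hle : ∀ᵐ x ∂μ, ∀ n, f n x ≤ g x := by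
    filter_upwards [hmono, hlim] with x hx hx' n using hx.ge_of_tendsto hx' n
  refine le_antisymm (iSup_le fun n => hφ.2.1 _ _ (hf n) hg (ae_all_iff.1 hle n))
    (h f g hf hg ?_ ?_)
  · filter_upwards [hle] with x hx using ⟨g x, forall_mem_range.2 hx⟩
  · filter_upwards [hle, hmono, hlim] with x hx hx' hx''
    exact tendsto_nhds_unique hx'' (tendsto_atTop_ciSup hx' ⟨g x, forall_mem_range.2 hx⟩)

lemma MaxitiveL0.sigmaMaxitiveL0 {μ : Measure X} {φ : (X → ℝ) → EReal}
    (hmax : MaxitiveL0 φ) (hcont : ContFromBelowL0 μ φ) : SigmaMaxitiveL0 μ φ := by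
  intro f g hf hg hbdd hsup
  have hpm : ∀ n, Measurable (partialSups f n) ∧ φ (partialSups f n) ≤ ⨆ n, φ (f n) := by
    intro n
    induction n with
    | zero => simpa using ⟨hf 0, le_iSup (fun n => φ (f n)) 0⟩
    | succ n ih =>
      rw [partialSups_add_one]
      exact ⟨ih.1.sup (hf _), (hmax _ _ ih.1 (hf _)).trans
        (max_le ih.2 (le_iSup (fun n => φ (f n)) (n + 1)))⟩
  rw [← hcont (fun n => partialSups f n) g (fun n => (hpm n).1) hg
    (Eventually.of_forall fun x m n hmn => (partialSups f).mono hmn x) ?_]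
  · exact iSup_le fun n => (hpm n).2
  · filter_upwards [hbdd, hsup] with x hx hx'
    have hub : ∀ n, partialSups f n x ≤ g x := fun n => by
      rw [Pi.partialSups_apply]
      exact partialSups_le _ _ _ fun k _ => hx' ▸ le_ciSup hx k
    have hm : Monotone fun n => partialSups f n x := fun m n hmn => (partialSups f).mono hmn x
    have hb : BddAbove (range fun n => partialSups f n x) := ⟨g x, forall_mem_range.2 hub⟩
    have heq : ⨆ n, partialSups f n x = g x := by
      refine le_antisymm (ciSup_le hub) ?_
      rw [hx']
      exact ciSup_mono hb fun n => le_partialSups f n x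
    exact heq ▸ tendsto_atTop_ciSup hm hb

lemma sigmaMaxitiveL0_of_eq_essSup {μ : Measure X} {φ : (X → ℝ) → EReal} (I : X → ℝ≥0∞)
    (h : ∀ f : X → ℝ, Measurable f →
      φ f = essSup (fun x => (f x : EReal) - (I x : EReal)) μ) : SigmaMaxitiveL0 μ φ := by
  intro f g hf hg _ hsup
  refine EReal.le_of_forall_lt_iff_le.1 fun c hc => ?_
  have hfc : ∀ n, ∀ᵐ x ∂μ, ENNReal.ofReal (f n x - c) ≤ I x := fun n => by
    rw [← essSup_coe_sub_le_iff, ← h _ (hf n)]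
    exact (le_iSup (fun n => φ (f n)) n).trans hc.le
  rw [h g hg, essSup_coe_sub_le_iff]
  filter_upwards [ae_all_iff.2 hfc, hsup] with x hx hx'
  rcases eq_or_ne (I x) ∞ with hI | hI
  · simp [hI]
  · rw [ENNReal.ofReal_le_iff_le_toReal hI, hx', sub_le_iff_le_add]
    exact ciSup_le fun n => sub_le_iff_le_add.1 ((ENNReal.ofReal_le_iff_le_toReal hI).1 (hx n))

lemma SigmaMaxitiveL0.exists_eq_essSup {μ : Measure X} [IsFiniteMeasure μ]
    {φ : (X → ℝ) → EReal} (hφ : IsMonetaryRiskMeasure μ φ) (h : SigmaMaxitiveL0 μ φ) :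
    ∃ I : X → ℝ≥0∞, Measurable I ∧ ∀ f : X → ℝ, Measurable f →
      φ f = essSup (fun x => (f x : EReal) - (I x : EReal)) μ := by
  let A : Set (X → ℝ≥0∞) :=
    {u | ∃ f : X → ℝ, (Measurable f ∧ φ f ≤ 0) ∧ u = fun x => ENNReal.ofReal (f x)}
  have hAm : ∀ u ∈ A, Measurable u := by
    rintro _ ⟨f, ⟨hf, -⟩, rfl⟩
    exact hf.ennreal_ofReal
  obtain ⟨u, huA, hu⟩ := exists_seq_forall_ae_le_iSup μ A hAm
    ⟨_, fun _ => 0, ⟨measurable_const, hφ.1.le⟩, rfl⟩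
  refine ⟨fun x => ⨆ n, u n x, Measurable.iSup fun n => hAm _ (huA n), ?_⟩
  choose k hk hku using huA
  have key : ∀ f : X → ℝ, Measurable f →
      (φ f ≤ 0 ↔ ∀ᵐ x ∂μ, ENNReal.ofReal (f x) ≤ ⨆ n, u n x) := by
    intro f hf
    refine ⟨fun hf0 => hu _ ⟨f, ⟨hf, hf0⟩, rfl⟩, fun hle => ?_⟩
    have hkm : ∀ n, Measurable fun x => max (k n x) 0 := fun n => (hk n).1.max measurable_const
    have hwm : ∀ n, Measurable fun x => min (f x) (max (k n x) 0) := fun n => hf.min (hkm n)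
    refine (h (fun n x => min (f x) (max (k n x) 0)) f hwm hf ?_ ?_).trans (iSup_le fun n => ?_)
    · exact Eventually.of_forall fun x => ⟨f x, forall_mem_range.2 fun n => min_le_left _ _⟩
    · filter_upwards [hle] with x hx
      refine (ciSup_eq_of_forall_le_of_forall_lt_exists_gt (fun n => min_le_left _ _)
        fun c hc => ?_).symm
      rcases lt_or_ge c 0 with hc0 | hc0
      · exact ⟨0, lt_min hc (lt_max_of_lt_right hc0)⟩
      · have hlt : ENNReal.ofReal c < ⨆ n, u n x :=
          ((ENNReal.ofReal_lt_ofReal_iff (hc0.trans_lt hc)).2 hc).trans_le hx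
        obtain ⟨n, hn⟩ := lt_iSup_iff.1 hlt
        rw [hku n] at hn
        exact ⟨n, lt_min hc (lt_max_of_lt_left ((ENNReal.ofReal_lt_ofReal_iff_of_nonneg hc0).1 hn))⟩
    · refine (hφ.2.1 _ _ (hwm n) (hkm n) (Eventually.of_forall fun x => min_le_right _ _)).trans ?_
      exact (h.maxitiveL0 _ _ (hk n).1 measurable_const).trans (max_le (hk n).2 hφ.1.le)
  intro f hf
  refine EReal.eq_of_forall_le_coe_iff fun c => ?_
  rw [hφ.le_coe_iff hf, key _ (hf.sub_const c), essSup_coe_sub_le_iff]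

/-- A penalty representing `φ` is dominated almost everywhere by any other one. -/
lemma ae_le_of_eq_essSup {μ : Measure X} {φ : (X → ℝ) → EReal} {I I' : X → ℝ≥0∞}
    (hI : Measurable I)
    (h : ∀ f : X → ℝ, Measurable f →
      φ f = essSup (fun x => (f x : EReal) - (I x : EReal)) μ)
    (h' : ∀ f : X → ℝ, Measurable f →
      φ f = essSup (fun x => (f x : EReal) - (I' x : EReal)) μ) :
    I ≤ᵐ[μ] I' := by
  let f : ℕ → X → ℝ := fun n x => (min (I x) n).toReal
  have hfI : ∀ n x, ENNReal.ofReal (f n x - (0 : ℝ)) = min (I x) n := fun n x => by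
    rw [sub_zero, ENNReal.ofReal_toReal (ne_top_of_le_ne_top (natCast_ne_top n) (min_le_right _ _))]
  have hle : ∀ n : ℕ, ∀ᵐ x ∂μ, min (I x) n ≤ I' x := fun n => by
    have hf : Measurable (f n) := (hI.min measurable_const).ennreal_toReal
    have hφ : φ (f n) ≤ (0 : ℝ) := by
      rw [h _ hf, essSup_coe_sub_le_iff]
      exact Eventually.of_forall fun x => (hfI n x).trans_le (min_le_left _ _)
    rw [h' _ hf, essSup_coe_sub_le_iff] at hφ
    simpa only [hfI] using hφ
  filter_upwards [ae_all_iff.2 hle] with x hx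
  refine ENNReal.le_of_forall_nnreal_lt fun r hr => ?_
  obtain ⟨n, hn⟩ := exists_nat_ge r
  exact (le_min hr.le (by exact_mod_cast hn)).trans (hx n)

/-- A monetary risk measure on `L⁰` is maxitive and continuous from below iff it is
σ-maxitive, iff it is a penalized maximum loss `f ↦ ess.sup_X (f - I)` on all of `L⁰`;
moreover the penalty `I` is μ-a.s. unique. -/
theorem sigmaMaxitive_characterization
    (μ : Measure X) [IsProbabilityMeasure μ]
    (φ : (X → ℝ) → EReal) (hφ : IsMonetaryRiskMeasure μ φ) :
    ((MaxitiveL0 φ ∧ ContFromBelowL0 μ φ) ↔ SigmaMaxitiveL0 μ φ) ∧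
    ((MaxitiveL0 φ ∧ ContFromBelowL0 μ φ) ↔
      ∃ I : X → ℝ≥0∞, Measurable I ∧ ∀ f : X → ℝ, Measurable f →
        φ f = essSup (fun x => (f x : EReal) - (I x : EReal)) μ) ∧
    (∀ I I' : X → ℝ≥0∞, Measurable I → Measurable I' →
      (∀ f : X → ℝ, Measurable f →
        φ f = essSup (fun x => (f x : EReal) - (I x : EReal)) μ) →
      (∀ f : X → ℝ, Measurable f →
        φ f = essSup (fun x => (f x : EReal) - (I' x : EReal)) μ) →
      I =ᵐ[μ] I') := by
  have h12 : (MaxitiveL0 φ ∧ ContFromBelowL0 μ φ) ↔ SigmaMaxitiveL0 μ φ :=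
    ⟨fun h => h.1.sigmaMaxitiveL0 h.2, fun h => ⟨h.maxitiveL0, h.contFromBelowL0 hφ⟩⟩
  refine ⟨h12, h12.trans ⟨fun h => h.exists_eq_essSup hφ, ?_⟩, ?_⟩
  · rintro ⟨I, -, h⟩
    exact sigmaMaxitiveL0_of_eq_essSup I h
  · intro I I' hI hI' h h'
    exact (ae_le_of_eq_essSup hI h h').antisymm (ae_le_of_eq_essSup hI' h' h)
end
end

section
/- Let φ : L⁰ → [−∞,∞] be a monetary risk measure that is maxitive on L⁰, let I : X → [0,∞] be measurable, and suppose there is a countable family (A_k)_{k∈ℕ} ⊂ 𝒳 such that: (1) {I < ∞} = ∪_{k∈ℕ} A_k up to a μ-null set; (2) J_{A_k^c} → −∞ as k → ∞; (3) for each k ∈ ℕ, J_B = −ess.inf_B I for every B ∈ 𝒳 with B ⊂ A_k. Then φ(f) = ess.sup_X(f − I) for every f ∈ L^φ := { f ∈ L⁰ : φ(t f) < ∞ for some t > 1 }. -/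
open MeasureTheory Filter Set Topology ENNReal

noncomputable section

variable {X : Type*} [MeasurableSpace X]

/-- On a set of concentration below `b - a`, the constant `a` is dominated by a function of risk
at most `b`. -/
theorem IsMonetaryRiskMeasure.exists_le_of_conc_lt {μ : Measure X} {φ : (X → ℝ) → EReal}
    (hφ : IsMonetaryRiskMeasure μ φ) {B : Set X} (hB : MeasurableSet B) {a b : ℝ}
    (h : conc φ B < ((b - a : ℝ) : EReal)) :
    ∃ u : X → ℝ, Measurable u ∧ φ u ≤ b ∧ ∀ x ∈ B, a ≤ u x := by
  obtain ⟨r, hr⟩ := iInf_lt_iff.1 h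
  have hm : Measurable (Bᶜ.indicator fun _ : X => (r : ℝ)) :=
    measurable_const.indicator hB.compl
  refine ⟨fun x => Bᶜ.indicator (fun _ => (r : ℝ)) x + a, hm.add_const a, ?_, ?_⟩
  · rw [hφ.2.2 _ hm]
    calc _ ≤ ((b - a : ℝ) : EReal) + a := by gcongr
      _ = b := by norm_cast; ring_nf
  · intro x hx
    simp [hx]

/-- If `f` exceeds the level `q` on `B` and `φ f < c`, then `B` has concentration below
`c - q`. -/
theorem conc_lt_of_forall_lt {μ : Measure X} {φ : (X → ℝ) → EReal}
    (hφ : IsMonetaryRiskMeasure μ φ) (hmax : MaxitiveL0 φ) {f : X → ℝ} (hf : Measurable f)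
    {B : Set X} (hB : MeasurableSet B) {q c : ℝ} (hq : ∀ x ∈ B, q < f x)
    (hc : φ f < c) : conc φ B < ((c - q : ℝ) : EReal) := by
  obtain ⟨r, hr0, hrc⟩ : ∃ r : ℝ, r < 0 ∧ r + q < c :=
    ⟨min (-1) (c - q - 1), by simp, by linarith [min_le_right (-1) (c - q - 1)]⟩
  have hm : Measurable (Bᶜ.indicator fun _ : X => r) := measurable_const.indicator hB.compl
  have h : φ (Bᶜ.indicator fun _ => r) + q < c := by
    rw [← hφ.2.2 _ hm]
    calc _ ≤ φ (fun x => max (f x) (r + q)) := by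
          refine hφ.2.1 _ _ (hm.add_const q) (hf.max measurable_const) (.of_forall fun x => ?_)
          by_cases hx : x ∈ B
          · simp [hx, (hq x hx).le]
          · simp [hx]
      _ ≤ max (φ f) (φ fun _ => r + q) := hmax f _ hf measurable_const
      _ < c := by
          rw [hφ.apply_const]
          exact max_lt hc (by exact_mod_cast hrc)
  refine (iInf_le _ (⟨r, hr0⟩ : {r : ℝ // r < 0})).trans_lt ?_
  rw [EReal.coe_sub]
  exact EReal.lt_sub_iff_add_lt (by simp) (by simp) |>.2 h

theorem essSup_sub_le_of_conc {μ : Measure X} {φ : (X → ℝ) → EReal}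
    (hφ : IsMonetaryRiskMeasure μ φ) (hmax : MaxitiveL0 φ) {I : X → ℝ≥0∞}
    {A : ℕ → Set X} (hA : ∀ k, MeasurableSet (A k))
    (h1 : {x | I x < ⊤} =ᵐ[μ] ⋃ k, A k)
    (h3 : ∀ k, ∀ B : Set X, MeasurableSet B → B ⊆ A k →
      -(essInf (fun x => (I x : EReal)) (μ.restrict B)) ≤ conc φ B)
    {f : X → ℝ} (hf : Measurable f) :
    essSup (fun x => (f x : EReal) - (I x : EReal)) μ ≤ φ f := by
  refine EReal.le_of_forall_lt_iff_le.1 fun c hc => essSup_le_of_ae_le _ ?_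
  have hnull (k : ℕ) (q : ℚ) :
      ∀ᵐ x ∂μ, x ∈ A k → (q : ℝ) < f x → ((q - c : ℝ) : EReal) ≤ I x := by
    have hB : MeasurableSet (A k ∩ {x | (q : ℝ) < f x}) :=
      (hA k).inter (measurableSet_lt measurable_const hf)
    have hJ := (h3 k _ hB inter_subset_left).trans_lt
      (conc_lt_of_forall_lt hφ hmax hf hB (fun x hx => hx.2) hc)
    have hJ' : ((q - c : ℝ) : EReal) <
        essInf (fun x => (I x : EReal)) (μ.restrict (A k ∩ {x | (q : ℝ) < f x})) := by
      rw [EReal.neg_lt_comm, ← EReal.coe_neg, neg_sub] at hJ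
      exact hJ
    filter_upwards [(ae_restrict_iff' hB).1 (ae_lt_of_lt_essInf hJ')] with x hx hk hq
    exact (hx ⟨hk, hq⟩).le
  filter_upwards [ae_all_iff.2 fun k => ae_all_iff.2 (hnull k), h1.mem_iff] with x hx hx1
  by_cases hIx : I x = ⊤
  · simp [hIx]
  obtain ⟨k, hk⟩ := mem_iUnion.1 (hx1.1 (lt_top_iff_ne_top.2 hIx))
  specialize hx k
  lift I x to NNReal using hIx with i
  have hx' : ∀ q : ℚ, (q : ℝ) < f x → q - c ≤ i := fun q hq => by
    have := hx q hk hq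
    rwa [EReal.coe_nnreal_eq_coe_real, EReal.coe_le_coe_iff] at this
  rw [EReal.coe_nnreal_eq_coe_real, ← EReal.coe_sub, EReal.coe_le_coe_iff]
  by_contra! hlt
  obtain ⟨q, hq1, hq2⟩ := exists_rat_btwn (lt_sub_iff_add_lt.1 hlt)
  linarith [hx' q hq2]

theorem le_essSup_sub_of_conc {μ : Measure X} {φ : (X → ℝ) → EReal}
    (hφ : IsMonetaryRiskMeasure μ φ) (hmax : MaxitiveL0 φ) {I : X → ℝ≥0∞}
    {A : ℕ → Set X} (hA : ∀ k, MeasurableSet (A k))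
    (h2 : Tendsto (fun k => conc φ (A k)ᶜ) atTop (𝓝 (⊥ : EReal)))
    (h3 : ∀ k, ∀ B : Set X, MeasurableSet B → B ⊆ A k →
      conc φ B ≤ -(essInf (fun x => (I x : EReal)) (μ.restrict B)))
    {f : X → ℝ} (hf : Measurable f) {t : ℝ} (ht : 1 < t) (hft : φ (fun x => t * f x) < ⊤) :
    φ f ≤ essSup (fun x => (f x : EReal) - (I x : EReal)) μ := by
  refine EReal.le_of_forall_lt_iff_le.1 fun b hb => ?_
  obtain ⟨M, hSM, hMb⟩ := EReal.lt_iff_exists_real_btwn.1 hb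
  have hMb' : M < b := by exact_mod_cast hMb
  let Q (S : Set X) : Prop := ∃ u : X → ℝ, Measurable u ∧ φ u ≤ b ∧ ∀ x ∈ S, f x ≤ u x
  have Q_union {S T : Set X} (hS : Q S) (hT : Q T) : Q (S ∪ T) := by
    obtain ⟨u, hu, hub, huS⟩ := hS
    obtain ⟨v, hv, hvb, hvT⟩ := hT
    refine ⟨fun x => max (u x) (v x), hu.max hv, (hmax u v hu hv).trans (max_le hub hvb), ?_⟩
    rintro x (hx | hx)
    · exact (huS x hx).trans (le_max_left _ _)
    · exact (hvT x hx).trans (le_max_right _ _)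
  have Q_mono {S T : Set X} (hS : Q S) (hTS : T ⊆ S) : Q T := by
    obtain ⟨u, hu, hub, huS⟩ := hS
    exact ⟨u, hu, hub, fun x hx => huS x (hTS hx)⟩
  have Q_level {B : Set X} (hB : MeasurableSet B) {a : ℝ} (hBa : ∀ x ∈ B, f x ≤ a)
      (h : conc φ B < ((b - a : ℝ) : EReal)) : Q B := by
    obtain ⟨u, hu, hub, huB⟩ := hφ.exists_le_of_conc_lt hB h
    exact ⟨u, hu, hub, fun x hx => (hBa x hx).trans (huB x hx)⟩
  obtain ⟨n, hn⟩ : ∃ n : ℝ, Q {x | n < f x} := by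
    obtain ⟨C, hC, -⟩ := EReal.lt_iff_exists_real_btwn.1 hft
    have ht' : 0 < t - 1 := sub_pos.2 ht
    refine ⟨(C - b) / (t - 1), fun x => t * f x + (b - C),
      (hf.const_mul t).add_const _, ?_, fun x hx => ?_⟩
    · rw [hφ.2.2 _ (hf.const_mul t)]
      calc _ ≤ (C : EReal) + ((b - C : ℝ) : EReal) := by gcongr
        _ = b := by norm_cast; ring_nf
    · have := (div_lt_iff₀ ht').1 hx
      linarith
  obtain ⟨k, hk⟩ := (h2.eventually_lt_const (EReal.bot_lt_coe (b - n))).exists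
  have hcompl : Q (A k)ᶜ := by
    obtain ⟨u, hu, hub, huB⟩ := hφ.exists_le_of_conc_lt (hA k).compl hk
    refine Q_mono (Q_union hn (T := (A k)ᶜ ∩ {x | f x ≤ n}) ⟨u, hu, hub, fun x hx => ?_⟩)
      fun x hx => ?_
    · exact (show f x ≤ n from hx.2).trans (huB x hx.1)
    · rcases lt_or_ge n (f x) with h | h
      · exact Or.inl h
      · exact Or.inr ⟨hx, h⟩
  obtain ⟨ε, hε, hεb⟩ : ∃ ε : ℝ, 0 < ε ∧ M + ε < b :=
    ⟨(b - M) / 2, by linarith, by linarith⟩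
  have hladder (j : ℕ) : Q (A k ∩ {x | f x < M + j * ε}) := by
    induction j with
    | zero =>
      refine ⟨fun _ => M, measurable_const, ?_, fun x hx => ?_⟩
      · rw [hφ.apply_const]
        exact hMb.le
      · simpa using (show f x < M + (0 : ℕ) * ε from hx.2).le
    | succ j ih =>
      let B : Set X := A k ∩ {x | M + j * ε ≤ f x} ∩ {x | f x ≤ M + (j + 1) * ε}
      have hB : MeasurableSet B :=
        ((hA k).inter (measurableSet_le measurable_const hf)).inter
          (measurableSet_le hf measurable_const)
      have hinf : ((j * ε : ℝ) : EReal) ≤ essInf (fun x => (I x : EReal)) (μ.restrict B) := by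
        refine le_essInf_of_ae_le _ ((ae_restrict_iff' hB).2 ?_)
        filter_upwards [ae_lt_of_essSup_lt hSM] with x hx hxB
        have hfx : M + j * ε ≤ f x := hxB.1.2
        by_cases hIx : I x = ⊤
        · simp [hIx]
        lift I x to NNReal using hIx with i
        rw [EReal.coe_nnreal_eq_coe_real, ← EReal.coe_sub, EReal.coe_lt_coe_iff] at hx
        rw [EReal.coe_nnreal_eq_coe_real, EReal.coe_le_coe_iff]
        linarith
      have hQB : Q B := by
        refine Q_level hB (fun x hx => hx.2) ?_
        calc conc φ B ≤ -(essInf (fun x => (I x : EReal)) (μ.restrict B)) :=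
              h3 k B hB fun x hx => hx.1.1
          _ ≤ ((-(j * ε) : ℝ) : EReal) := by
              rw [EReal.coe_neg]
              exact EReal.neg_le_neg_iff.2 hinf
          _ < _ := by
              rw [EReal.coe_lt_coe_iff]
              linarith
      refine Q_mono (Q_union ih hQB) fun x hx => ?_
      rcases lt_or_ge (f x) (M + j * ε) with h | h
      · exact Or.inl ⟨hx.1, h⟩
      · exact Or.inr ⟨⟨hx.1, h⟩, by exact_mod_cast (show f x < M + (j + 1 : ℕ) * ε from hx.2).le⟩
  obtain ⟨N, hN⟩ := exists_nat_gt ((n - M) / ε)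
  have hNn : n < M + N * ε := by
    linarith [(div_lt_iff₀ hε).1 hN]
  obtain ⟨u, hu, hub, hfu⟩ : Q univ := by
    refine Q_mono (Q_union hn (Q_union hcompl (hladder N))) fun x _ => ?_
    by_cases hx : x ∈ A k
    · rcases lt_or_ge n (f x) with h | h
      · exact Or.inl h
      · exact Or.inr (Or.inr ⟨hx, h.trans_lt hNn⟩)
    · exact Or.inr (Or.inl hx)
  exact (hφ.2.1 f u hf hu (.of_forall fun x => hfu x (mem_univ x))).trans hub

/-- Local criterion for the penalized maximum loss representation: if `φ` is a maxitive
monetary risk measure, `{I < ∞} = ⋃ k, A k` up to a μ-null set, `J_{(A k)ᶜ} → -∞`, and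
`J_B = - ess.inf_B I` for every measurable `B ⊆ A k`, then `φ f = ess.sup_X (f - I)` for
every `f ∈ L^φ`. -/
theorem local_criterion_penalizedMaxLoss
    (μ : Measure X) [IsProbabilityMeasure μ]
    (φ : (X → ℝ) → EReal) (hφ : IsMonetaryRiskMeasure μ φ)
    (hmax : MaxitiveL0 φ)
    (I : X → ℝ≥0∞) (hI : Measurable I)
    (A : ℕ → Set X) (hA : ∀ k, MeasurableSet (A k))
    (h1 : {x | I x < ⊤} =ᵐ[μ] ⋃ k, A k)
    (h2 : Tendsto (fun k => conc φ (A k)ᶜ) atTop (𝓝 (⊥ : EReal)))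
    (h3 : ∀ k, ∀ B : Set X, MeasurableSet B → B ⊆ A k →
      conc φ B = -(essInf (fun x => (I x : EReal)) (μ.restrict B))) :
    ∀ f : X → ℝ, Measurable f → (∃ t : ℝ, 1 < t ∧ φ (fun x => t * f x) < ⊤) →
      φ f = essSup (fun x => (f x : EReal) - (I x : EReal)) μ := by
  rintro f hf ⟨t, ht, hft⟩
  exact le_antisymm
    (le_essSup_sub_of_conc hφ hmax hA h2 (fun k B hB hBA => (h3 k B hB hBA).le) hf ht hft)
    (essSup_sub_le_of_conc hφ hmax hA h1 (fun k B hB hBA => (h3 k B hB hBA).ge) hf)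
end
end

section
/- Let (ν_n)_{n∈ℕ} be a sequence of probability measures on (X, 𝒳) with ν_n ≪ μ for all n, let I : X → [0,∞] be measurable, and let φ(f) := limsup_{n→∞} (1/n) log ∫_X e^{n f} dν_n for f ∈ L⁰. Then (ν_n) satisfies the sharp large deviation principle with rate I, i.e. lim_{n→∞} (1/n) log ν_n(A) = −ess.inf_A I for all A ∈ 𝒳, if and only if for every f ∈ L^φ := { f ∈ L⁰ : φ(t f) < ∞ for some t > 1 } the limit lim_{n→∞} (1/n) log ∫_X e^{n f} dν_n exists and equals ess.sup_X(f − I). -/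
open MeasureTheory Filter Set Topology ENNReal

noncomputable section

variable {X : Type*} [MeasurableSpace X]

/-- The sequence `(ν n)` satisfies the sharp large deviation principle with rate `I`:
`lim_n (1/n) log ν_n(A) = - ess.inf_A I` for every measurable `A`. -/
def SharpLDP (μ : Measure X) (ν : ℕ → Measure X) (I : X → ℝ≥0∞) : Prop :=
  ∀ A : Set X, MeasurableSet A →
    Tendsto (fun n : ℕ => (((n : ℝ)⁻¹ : ℝ) : EReal) * ENNReal.log (ν n A)) atTop
      (𝓝 (-(essInf (fun x => (I x : EReal)) (μ.restrict A))))

/-- The upper Varadhan functional `φ f = limsup_n (1/n) log ∫ e^{n f} dν_n`. -/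
def varadhan (ν : ℕ → Measure X) (f : X → ℝ) : EReal :=
  Filter.limsup (fun n : ℕ => (((n : ℝ)⁻¹ : ℝ) : EReal) *
    ENNReal.log (∫⁻ x, ENNReal.ofReal (Real.exp ((n : ℝ) * f x)) ∂ν n)) atTop

/-- The exponential growth `e^{n c}` as an extended nonnegative real. -/
def expGrowth (c : ℝ) (n : ℕ) : ℝ≥0∞ := ENNReal.ofReal (Real.exp ((n : ℝ) * c))

lemma expGrowth_mul (a b : ℝ) (n : ℕ) :
    expGrowth a n * expGrowth b n = expGrowth (a + b) n := by
  rw [expGrowth, expGrowth, expGrowth, ← ENNReal.ofReal_mul (Real.exp_pos _).le, ← Real.exp_add,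
    mul_add]

lemma expGrowth_mono {a b : ℝ} (h : a ≤ b) (n : ℕ) : expGrowth a n ≤ expGrowth b n := by
  unfold expGrowth
  gcongr

lemma log_expGrowth (c : ℝ) (n : ℕ) : ENNReal.log (expGrowth c n) = ((n * c : ℝ) : EReal) := by
  rw [expGrowth, ENNReal.log_ofReal_of_pos (Real.exp_pos _), Real.log_exp]

lemma inv_mul_log_le_iff {n : ℕ} (hn : 0 < n) (a : ℝ≥0∞) (c : ℝ) :
    (((n : ℝ)⁻¹ : ℝ) : EReal) * ENNReal.log a ≤ c ↔ a ≤ expGrowth c n := by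
  have hn' : (0 : ℝ) < n := by exact_mod_cast hn
  rw [← ENNReal.log_le_log_iff, log_expGrowth]
  induction ENNReal.log a with
  | bot => simp [EReal.coe_mul_bot_of_pos (inv_pos.2 hn')]
  | top => simp [EReal.coe_mul_top_of_pos (inv_pos.2 hn'), -EReal.coe_mul]
  | coe x =>
    rw [← EReal.coe_mul, EReal.coe_le_coe_iff, EReal.coe_le_coe_iff, inv_mul_le_iff₀ hn']

lemma le_inv_mul_log_iff {n : ℕ} (hn : 0 < n) (a : ℝ≥0∞) (c : ℝ) :
    (c : EReal) ≤ (((n : ℝ)⁻¹ : ℝ) : EReal) * ENNReal.log a ↔ expGrowth c n ≤ a := by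
  have hn' : (0 : ℝ) < n := by exact_mod_cast hn
  rw [← ENNReal.log_le_log_iff, log_expGrowth]
  induction ENNReal.log a with
  | bot => simp [EReal.coe_mul_bot_of_pos (inv_pos.2 hn'), -EReal.coe_mul]
  | top => simp [EReal.coe_mul_top_of_pos (inv_pos.2 hn')]
  | coe x =>
    rw [← EReal.coe_mul, EReal.coe_le_coe_iff, EReal.coe_le_coe_iff, le_inv_mul_iff₀ hn']

lemma tendsto_inv_mul_log_iff (u : ℕ → ℝ≥0∞) (L : EReal) :
    Tendsto (fun n : ℕ => (((n : ℝ)⁻¹ : ℝ) : EReal) * ENNReal.log (u n)) atTop (𝓝 L) ↔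
      (∀ c : ℝ, (c : EReal) < L → ∀ᶠ n in atTop, expGrowth c n ≤ u n) ∧
      (∀ c : ℝ, L < c → ∀ᶠ n in atTop, u n ≤ expGrowth c n) := by
  rw [tendsto_order]
  constructor
  · rintro ⟨h1, h2⟩
    refine ⟨fun c hc => ?_, fun c hc => ?_⟩
    · filter_upwards [h1 c hc, eventually_gt_atTop 0] with n hn h0
      exact (le_inv_mul_log_iff h0 _ _).1 hn.le
    · filter_upwards [h2 c hc, eventually_gt_atTop 0] with n hn h0
      exact (inv_mul_log_le_iff h0 _ _).1 hn.le
  · rintro ⟨h1, h2⟩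
    refine ⟨fun a ha => ?_, fun a ha => ?_⟩
    · obtain ⟨c, hac, hcL⟩ := EReal.lt_iff_exists_real_btwn.1 ha
      filter_upwards [h1 c hcL, eventually_gt_atTop 0] with n hn h0
      exact hac.trans_le ((le_inv_mul_log_iff h0 _ _).2 hn)
    · obtain ⟨c, hLc, hca⟩ := EReal.lt_iff_exists_real_btwn.1 ha
      filter_upwards [h2 c hLc, eventually_gt_atTop 0] with n hn h0
      exact ((inv_mul_log_le_iff h0 _ _).2 hn).trans_lt hca

lemma eventually_natCast_mul_expGrowth_le (k : ℕ) {a b : ℝ} (hab : a < b) :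
    ∀ᶠ n in atTop, (k : ℝ≥0∞) * expGrowth a n ≤ expGrowth b n := by
  have h : Tendsto (fun n : ℕ => Real.exp ((n : ℝ) * (b - a))) atTop atTop :=
    Real.tendsto_exp_atTop.comp
      (tendsto_natCast_atTop_atTop.atTop_mul_const (sub_pos.2 hab))
  filter_upwards [h.eventually_ge_atTop (k : ℝ)] with n hn
  calc (k : ℝ≥0∞) * expGrowth a n ≤ expGrowth (b - a) n * expGrowth a n := by
        gcongr
        rw [expGrowth, ← ENNReal.ofReal_natCast]
        exact ENNReal.ofReal_le_ofReal hn
    _ = expGrowth b n := by rw [expGrowth_mul, sub_add_cancel]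

lemma exists_eventually_lintegral_le_of_varadhan_lt_top {ν : ℕ → Measure X} {f : X → ℝ}
    (h : varadhan ν f < ⊤) :
    ∃ K : ℝ, ∀ᶠ n in atTop, ∫⁻ x, expGrowth (f x) n ∂ν n ≤ expGrowth K n := by
  obtain ⟨K, hK, -⟩ := EReal.lt_iff_exists_real_btwn.1 h
  refine ⟨K, ?_⟩
  filter_upwards [eventually_lt_of_limsup_lt hK, eventually_gt_atTop 0] with n hn h0
  exact (inv_mul_log_le_iff h0 _ _).1 hn.le

lemma varadhan_lt_top_of_le {ν : ℕ → Measure X} (hprob : ∀ n, IsProbabilityMeasure (ν n))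
    {f : X → ℝ} {K : ℝ} (h : ∀ x, f x ≤ K) : varadhan ν f < ⊤ := by
  refine lt_of_le_of_lt ?_ (EReal.coe_lt_top K)
  refine limsup_le_of_le (by isBoundedDefault) ?_
  filter_upwards [eventually_gt_atTop 0] with n h0
  refine (inv_mul_log_le_iff h0 _ _).2 ?_
  calc ∫⁻ x, expGrowth (f x) n ∂ν n ≤ ∫⁻ _, expGrowth K n ∂ν n :=
        lintegral_mono fun x => expGrowth_mono (h x) n
    _ = expGrowth K n := by simp

lemma measurable_expGrowth {f : X → ℝ} (hf : Measurable f) (n : ℕ) :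
    Measurable fun x => expGrowth (f x) n :=
  ENNReal.measurable_ofReal.comp (Real.measurable_exp.comp (hf.const_mul _))

lemma eventually_expGrowth_le_lintegral {μ : Measure X} {ν : ℕ → Measure X} {I : X → ℝ≥0∞}
    (hI : Measurable I) (hldp : SharpLDP μ ν I) {f : X → ℝ} (hf : Measurable f) {c : ℝ}
    (hc : (c : EReal) < essSup (fun x => (f x : EReal) - (I x : EReal)) μ) :
    ∀ᶠ n in atTop, expGrowth c n ≤ ∫⁻ x, expGrowth (f x) n ∂ν n := by
  obtain ⟨c', hcc', hc'⟩ := EReal.lt_iff_exists_real_btwn.1 hc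
  rw [EReal.coe_lt_coe_iff] at hcc'
  let A : ℚ → Set X := fun b => {x | (I x : EReal) ≤ ((b : ℝ) : EReal)} ∩ {x | (b : ℝ) + c' ≤ f x}
  have hA : ∀ b, MeasurableSet (A b) := fun b =>
    (measurableSet_le hI.coe_ereal_ennreal measurable_const).inter
      (measurableSet_le measurable_const hf)
  obtain ⟨b, hb⟩ : ∃ b, μ (A b) ≠ 0 := by
    by_contra! h
    refine hc'.not_ge (essSup_le_of_ae_le _ ?_)
    have h' : ∀ᵐ x ∂μ, ∀ b, x ∉ A b := ae_all_iff.2 fun b => measure_eq_zero_iff_ae_notMem.1 (h b)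
    filter_upwards [h'] with x hx
    by_contra! hlt
    have hx1 : (I x : EReal) < ((f x - c' : ℝ) : EReal) := by
      rw [EReal.coe_sub]
      induction h : (I x : EReal) with
      | bot => exact EReal.bot_lt_coe (f x - c')
      | top => simp [h] at hlt
      | coe i =>
        rw [h] at hlt
        norm_cast at hlt ⊢
        linarith
    obtain ⟨b, hb1, hb2⟩ := EReal.lt_iff_exists_rat_btwn.1 hx1
    refine hx b ⟨hb1.le, ?_⟩
    have : (b : ℝ) < f x - c' := by exact_mod_cast hb2
    simp only [mem_ofPred_eq]
    linarith
  have hinf : essInf (fun x => (I x : EReal)) (μ.restrict (A b)) ≤ ((b : ℝ) : EReal) := by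
    by_contra! hlt
    refine hb (measure_eq_zero_iff_ae_notMem.2 ?_)
    filter_upwards [(ae_restrict_iff' (hA b)).1 (ae_lt_of_lt_essInf hlt)] with x hx hxA
    exact (hx hxA).not_ge hxA.1
  have hlow : ((-b - (c' - c) : ℝ) : EReal) <
      -essInf (fun x => (I x : EReal)) (μ.restrict (A b)) := by
    refine lt_of_lt_of_le ?_ (EReal.neg_le_neg_iff.2 hinf)
    rw [← EReal.coe_neg, EReal.coe_lt_coe_iff]
    linarith
  filter_upwards [((tendsto_inv_mul_log_iff _ _).1 (hldp _ (hA b))).1 _ hlow] with n hn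
  calc expGrowth c n = expGrowth (b + c') n * expGrowth (-b - (c' - c)) n := by
        rw [expGrowth_mul]; congr 1; ring
    _ ≤ expGrowth (b + c') n * ν n (A b) := by gcongr
    _ = ∫⁻ _ in A b, expGrowth (b + c') n ∂ν n := by simp
    _ ≤ ∫⁻ x in A b, expGrowth (f x) n ∂ν n :=
        setLIntegral_mono (measurable_expGrowth hf n) fun x hx => expGrowth_mono hx.2 n
    _ ≤ ∫⁻ x, expGrowth (f x) n ∂ν n := setLIntegral_le_lintegral _ _

/-- On the slab `a < f ≤ a + δ`, the integral of `e^{n f}` is bounded through the large deviation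
upper bound of the slab. -/
lemma eventually_expGrowth_mul_measure_slab_le {μ : Measure X} {ν : ℕ → Measure X}
    {I : X → ℝ≥0∞} (hldp : SharpLDP μ ν I) {f : X → ℝ} (hf : Measurable f) {c : ℝ}
    (hc : essSup (fun x => (f x : EReal) - (I x : EReal)) μ < c) (a δ : ℝ) :
    ∀ᶠ n in atTop, expGrowth (a + δ) n * ν n {x | a < f x ∧ f x ≤ a + δ} ≤
      expGrowth (c + δ) n := by
  obtain ⟨c', hc', hcc'⟩ := EReal.lt_iff_exists_real_btwn.1 hc
  rw [EReal.coe_lt_coe_iff] at hcc'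
  have hA : MeasurableSet {x | a < f x ∧ f x ≤ a + δ} :=
    (measurableSet_lt measurable_const hf).inter (measurableSet_le hf measurable_const)
  have hinf : ((a - c' : ℝ) : EReal) ≤
      essInf (fun x => (I x : EReal)) (μ.restrict {x | a < f x ∧ f x ≤ a + δ}) := by
    refine le_essInf_of_ae_le _ ((ae_restrict_iff' hA).2 ?_)
    filter_upwards [ae_lt_of_essSup_lt hc'] with x hx hxA
    induction h : (I x : EReal) with
    | bot => simp [h] at hx
    | top => exact le_top
    | coe i =>
      rw [h] at hx
      norm_cast at hx ⊢
      linarith [hxA.1]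
  have hup : -essInf (fun x => (I x : EReal)) (μ.restrict {x | a < f x ∧ f x ≤ a + δ}) <
      ((c - a : ℝ) : EReal) := by
    refine lt_of_le_of_lt (EReal.neg_le_neg_iff.2 hinf) ?_
    rw [← EReal.coe_neg, EReal.coe_lt_coe_iff]
    linarith
  filter_upwards [((tendsto_inv_mul_log_iff _ _).1 (hldp _ hA)).2 _ hup] with n hn
  calc _ ≤ expGrowth (a + δ) n * expGrowth (c - a) n := by gcongr
    _ = expGrowth (c + δ) n := by rw [expGrowth_mul]; congr 1; ring

lemma expGrowth_le_add_sum_slab {c δ t K : ℝ} (hδ : 0 < δ) (ht : 1 < t) {k : ℕ}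
    (hk : (K - c) / (t - 1) ≤ c + k * δ) (y : ℝ) (n : ℕ) :
    expGrowth y n ≤ expGrowth c n + (∑ i ∈ Finset.range k,
        ({z | c + i * δ < z ∧ z ≤ c + i * δ + δ}.indicator
          (fun _ => expGrowth (c + i * δ + δ) n) y)) +
      expGrowth (c - K) n * expGrowth (t * y) n := by
  by_cases hyc : y ≤ c
  · exact (expGrowth_mono hyc n).trans (le_self_add.trans le_self_add)
  by_cases hyM : c + k * δ < y
  · refine le_add_left ?_
    rw [expGrowth_mul]
    refine expGrowth_mono ?_ n
    have := (div_lt_iff₀ (sub_pos.2 ht)).1 (hk.trans_lt hyM)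
    linarith
  push Not at hyc hyM
  refine le_add_right (le_add_left ?_)
  set j := ⌈(y - c) / δ⌉₊ with hj
  have hpos : 0 < (y - c) / δ := div_pos (sub_pos.2 hyc) hδ
  have hj0 : 0 < j := Nat.ceil_pos.2 hpos
  have hjk : j ≤ k := Nat.ceil_le.2 ((div_le_iff₀ hδ).2 (by linarith))
  obtain ⟨i, hi⟩ : ∃ i, j = i + 1 := ⟨j - 1, by omega⟩
  have h1 : (y - c) / δ ≤ i + 1 := by
    have := Nat.le_ceil ((y - c) / δ)
    rw [← hj, hi] at this
    exact_mod_cast this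
  have h2 : (i : ℝ) < (y - c) / δ := Nat.lt_ceil.1 (by omega)
  rw [div_le_iff₀ hδ] at h1
  rw [lt_div_iff₀ hδ] at h2
  have hmem : y ∈ {z | c + i * δ < z ∧ z ≤ c + i * δ + δ} := by
    constructor <;> linarith
  refine le_trans ?_ (Finset.single_le_sum
    (f := fun i : ℕ => ({z | c + i * δ < z ∧ z ≤ c + i * δ + δ}.indicator
          (fun _ => expGrowth (c + i * δ + δ) n) y))
    (fun _ _ => zero_le) (Finset.mem_range.2 (show i < k by omega)))
  simp only [indicator_of_mem hmem]
  exact expGrowth_mono hmem.2 n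

lemma eventually_lintegral_le_expGrowth {μ : Measure X} {ν : ℕ → Measure X}
    (hprob : ∀ n, IsProbabilityMeasure (ν n)) {I : X → ℝ≥0∞}
    (hldp : SharpLDP μ ν I) {f : X → ℝ} (hf : Measurable f) {t : ℝ} (ht : 1 < t)
    (hft : varadhan ν (fun x => t * f x) < ⊤) {c : ℝ}
    (hc : essSup (fun x => (f x : EReal) - (I x : EReal)) μ < c) :
    ∀ᶠ n in atTop, ∫⁻ x, expGrowth (f x) n ∂ν n ≤ expGrowth c n := by
  obtain ⟨c₁, hc₁, hc₁c⟩ := EReal.lt_iff_exists_real_btwn.1 hc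
  obtain ⟨c₀, hc₀, hc₀₁⟩ := EReal.lt_iff_exists_real_btwn.1 hc₁
  rw [EReal.coe_lt_coe_iff] at hc₁c hc₀₁
  obtain ⟨K, hK⟩ := exists_eventually_lintegral_le_of_varadhan_lt_top hft
  set δ := c₁ - c₀ with hδ
  have hδ0 : 0 < δ := sub_pos.2 hc₀₁
  obtain ⟨k, hk⟩ := exists_nat_ge (((K - c₁) / (t - 1) - c₁) / δ)
  have hk' : (K - c₁) / (t - 1) ≤ c₁ + k * δ := by
    rw [div_le_iff₀ hδ0] at hk
    linarith
  have hslab : ∀ᶠ n in atTop, ∀ i ∈ Finset.range k,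
      expGrowth (c₁ + i * δ + δ) n *
        ν n {x | c₁ + i * δ < f x ∧ f x ≤ c₁ + i * δ + δ} ≤ expGrowth c₁ n := by
    rw [Filter.eventually_all_finset]
    intro i _
    have h := eventually_expGrowth_mul_measure_slab_le hldp hf hc₀ (c₁ + i * δ) δ
    rwa [show c₀ + δ = c₁ by rw [hδ]; ring] at h
  filter_upwards [hK, hslab, eventually_natCast_mul_expGrowth_le (k + 2) hc₁c] with n h1 h2 h3
  have hS : ∀ i : ℕ, MeasurableSet {z : ℝ | c₁ + i * δ < z ∧ z ≤ c₁ + i * δ + δ} :=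
    fun i => measurableSet_Ioc
  have hm : ∀ i : ℕ, Measurable fun x => {z | c₁ + i * δ < z ∧ z ≤ c₁ + i * δ + δ}.indicator
      (fun _ => expGrowth (c₁ + i * δ + δ) n) (f x) :=
    fun i => (measurable_const.indicator (hS i)).comp hf
  have hint : ∀ i : ℕ, ∫⁻ x, {z | c₁ + i * δ < z ∧ z ≤ c₁ + i * δ + δ}.indicator
      (fun _ => expGrowth (c₁ + i * δ + δ) n) (f x) ∂ν n =
      expGrowth (c₁ + i * δ + δ) n * ν n {x | c₁ + i * δ < f x ∧ f x ≤ c₁ + i * δ + δ} :=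
    fun i => lintegral_indicator_const (μ := ν n) (hf (hS i)) _
  refine le_trans (lintegral_mono fun x => expGrowth_le_add_sum_slab hδ0 ht hk' (f x) n)
    (le_trans ?_ h3)
  rw [lintegral_add_right _ ((measurable_expGrowth (hf.const_mul t) n).const_mul _),
    lintegral_add_left measurable_const, lintegral_finsetSum _ fun i _ => hm i,
    lintegral_const_mul _ (measurable_expGrowth (hf.const_mul t) n)]
  simp only [hint, lintegral_const, measure_univ, mul_one]
  calc _ ≤ expGrowth c₁ n + ∑ i ∈ Finset.range k, expGrowth c₁ n +
        expGrowth (c₁ - K) n * expGrowth K n := by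
        gcongr with i hi
        exact h2 i hi
    _ = ((k + 2 : ℕ) : ℝ≥0∞) * expGrowth c₁ n := by
        rw [expGrowth_mul, sub_add_cancel, Finset.sum_const, Finset.card_range, nsmul_eq_mul]
        push_cast
        ring

lemma measurable_indicator_compl_const {A : Set X} (hA : MeasurableSet A) (c : ℝ) :
    Measurable (Aᶜ.indicator fun _ => c) :=
  measurable_const.indicator hA.compl

lemma indicator_compl_const_varadhan {ν : ℕ → Measure X}
    (hprob : ∀ n, IsProbabilityMeasure (ν n)) (A : Set X) (c : ℝ) :
    ∃ t : ℝ, 1 < t ∧ varadhan ν (fun x => t * Aᶜ.indicator (fun _ => c) x) < ⊤ := by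
  refine ⟨2, one_lt_two, varadhan_lt_top_of_le (K := 2 * max c 0) hprob fun x => ?_⟩
  by_cases hx : x ∈ A <;> simp [hx]

lemma neg_essInf_restrict_le_essSup {μ : Measure X} {I : X → ℝ≥0∞} {A : Set X}
    (hA : MeasurableSet A) (c : ℝ) :
    -essInf (fun x => (I x : EReal)) (μ.restrict A) ≤
      essSup (fun x => ((Aᶜ.indicator (fun _ => c) x : ℝ) : EReal) - (I x : EReal)) μ := by
  rw [EReal.neg_le]
  refine le_essInf_of_ae_le _ ((ae_restrict_iff' hA).2 ?_)
  filter_upwards [ae_le_essSup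
    (f := fun x => ((Aᶜ.indicator (fun _ => c) x : ℝ) : EReal) - (I x : EReal))] with x hx hxA
  rw [EReal.neg_le]
  simpa [hxA] using hx

lemma essSup_indicator_compl_sub_le {μ : Measure X} {I : X → ℝ≥0∞} {A : Set X}
    (hA : MeasurableSet A) {c : ℝ}
    (hc : -essInf (fun x => (I x : EReal)) (μ.restrict A) ≤ c) :
    essSup (fun x => ((Aᶜ.indicator (fun _ => c) x : ℝ) : EReal) - (I x : EReal)) μ ≤ c := by
  refine essSup_le_of_ae_le _ ?_
  filter_upwards [(ae_restrict_iff' hA).1 (ae_essInf_le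
    (μ := μ.restrict A) (f := fun x => (I x : EReal)))] with x hx
  by_cases hxA : x ∈ A
  · simpa [hxA] using (EReal.neg_le_neg_iff.2 (hx hxA)).trans hc
  · have : (c : EReal) - (I x : EReal) ≤ c - 0 :=
      EReal.sub_le_sub le_rfl (EReal.coe_ennreal_nonneg _)
    simpa [hxA] using this

lemma lintegral_expGrowth_indicator_compl {ν : Measure X} {A : Set X} (hA : MeasurableSet A)
    (c : ℝ) (n : ℕ) :
    ∫⁻ x, expGrowth (Aᶜ.indicator (fun _ => c) x) n ∂ν = ν A + expGrowth c n * ν Aᶜ := by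
  rw [← lintegral_add_compl _ hA]
  congr 1
  · rw [setLIntegral_congr_fun hA (g := fun _ => 1) fun x hx => by simp [hx, expGrowth]]
    simp
  · rw [setLIntegral_congr_fun hA.compl (g := fun _ => expGrowth c n)
      fun x hx => by simp only [indicator_of_mem hx]]
    simp

/-- A sequence of probability measures `ν n ≪ μ` satisfies the sharp LDP with rate `I` iff
it satisfies the Laplace principle: for every `f ∈ L^φ` the limit
`lim_n (1/n) log ∫ e^{n f} dν_n` exists and equals `ess.sup_X (f - I)`. -/
theorem sharpLDP_iff_laplacePrinciple
    (μ : Measure X) [IsProbabilityMeasure μ]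
    (ν : ℕ → Measure X) (hprob : ∀ n, IsProbabilityMeasure (ν n))
    (hac : ∀ n, ν n ≪ μ)
    (I : X → ℝ≥0∞) (hI : Measurable I) :
    SharpLDP μ ν I ↔
      (∀ f : X → ℝ, Measurable f →
        (∃ t : ℝ, 1 < t ∧ varadhan ν (fun x => t * f x) < ⊤) →
        Tendsto (fun n : ℕ => (((n : ℝ)⁻¹ : ℝ) : EReal) *
            ENNReal.log (∫⁻ x, ENNReal.ofReal (Real.exp ((n : ℝ) * f x)) ∂ν n)) atTop
          (𝓝 (essSup (fun x => (f x : EReal) - (I x : EReal)) μ))) := by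
  constructor
  · rintro hldp f hf ⟨t, ht, hft⟩
    exact (tendsto_inv_mul_log_iff _ _).2
      ⟨fun c hc => eventually_expGrowth_le_lintegral hI hldp hf hc,
        fun c hc => eventually_lintegral_le_expGrowth hprob hldp hf ht hft hc⟩
  · intro hlap A hA
    have key : ∀ c : ℝ, _ := fun c => (tendsto_inv_mul_log_iff _ _).1
      (hlap _ (measurable_indicator_compl_const hA c) (indicator_compl_const_varadhan hprob A c))
    refine (tendsto_inv_mul_log_iff _ _).2 ⟨fun c hc => ?_, fun c hc => ?_⟩
    · obtain ⟨c', hcc', hc'⟩ := EReal.lt_iff_exists_real_btwn.1 hc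
      rw [EReal.coe_lt_coe_iff] at hcc'
      filter_upwards [(key c).1 c' (hc'.trans_le (neg_essInf_restrict_le_essSup hA c)),
        eventually_natCast_mul_expGrowth_le 2 hcc'] with n h1 h2
      have h3 : expGrowth c' n ≤ ν n A + expGrowth c n * ν n Aᶜ :=
        h1.trans_eq (lintegral_expGrowth_indicator_compl hA c n)
      have h4 : expGrowth c n + expGrowth c n ≤ ν n A + expGrowth c n := by
        rw [← two_mul]
        refine (h2.trans h3).trans ?_
        gcongr
        exact mul_le_of_le_one_right' prob_le_one
      exact (ENNReal.add_le_add_iff_right ENNReal.ofReal_ne_top).1 h4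
    · obtain ⟨c', hc', hcc'⟩ := EReal.lt_iff_exists_real_btwn.1 hc
      filter_upwards [(key c').2 c
        ((essSup_indicator_compl_sub_le hA hc'.le).trans_lt hcc')] with n h1
      have h2 : ν n A + expGrowth c' n * ν n Aᶜ ≤ expGrowth c n :=
        (lintegral_expGrowth_indicator_compl hA c' n).symm.trans_le h1
      exact le_self_add.trans h2
end
end

section
/- Let (ν_n)_{n∈ℕ} be a sequence of probability measures on (X, 𝒳) with ν_n ≪ μ for all n, and let I : X → [0,∞] be measurable. Suppose (A_k)_{k∈ℕ} ⊂ 𝒳 satisfies: (1) {I < ∞} = ∪_{k∈ℕ} A_k up to a μ-null set; (2) limsup_{n→∞} (1/n) log ν_n(A_k^c) → −∞ as k → ∞; (3) for each k ∈ ℕ, (1/n) log(dν_n/dμ) → −I as n → ∞ μ-a.s. uniformly on A_k (i.e. for every δ > 0 there is N such that for all n ≥ N, |(1/n) log(dν_n/dμ)(x) + I(x)| ≤ δ for μ-a.e. x ∈ A_k). Then lim_{n→∞} (1/n) log ν_n(A) = −ess.inf_A I for every A ∈ 𝒳, and for every f ∈ L^φ := { f ∈ L⁰ : limsup_{n→∞}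 (1/n) log ∫_X e^{t n f} dν_n < ∞ for some t > 1 } the limit lim_{n→∞} (1/n) log ∫_X e^{n f} dν_n exists and equals ess.sup_X(f − I). -/
open MeasureTheory Filter Set Topology ENNReal

noncomputable section

variable {X : Type*} [MeasurableSpace X]

theorem EReal.inv_natCast_mul_le_iff {n : ℕ} (hn : n ≠ 0) (x : EReal) (c : ℝ) :
    (((n : ℝ)⁻¹ : ℝ) : EReal) * x ≤ (c : EReal) ↔ x ≤ ((n * c : ℝ) : EReal) := by
  have hn : (0 : ℝ) < n := by positivity
  induction x with
  | bot => simp [EReal.coe_mul_bot_of_pos (inv_pos.2 hn)]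
  | top => rw [EReal.coe_mul_top_of_pos (inv_pos.2 hn)]; simp [-EReal.coe_mul]
  | coe x => norm_cast; rw [inv_mul_le_iff₀ hn]

theorem EReal.le_inv_natCast_mul_iff {n : ℕ} (hn : n ≠ 0) (x : EReal) (c : ℝ) :
    (c : EReal) ≤ (((n : ℝ)⁻¹ : ℝ) : EReal) * x ↔ ((n * c : ℝ) : EReal) ≤ x := by
  have hn : (0 : ℝ) < n := by positivity
  induction x with
  | bot => rw [EReal.coe_mul_bot_of_pos (inv_pos.2 hn)]; simp [-EReal.coe_mul]
  | top => rw [EReal.coe_mul_top_of_pos (inv_pos.2 hn)]; simp [-EReal.coe_mul]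
  | coe x => norm_cast; rw [le_inv_mul_iff₀ hn]

theorem ENNReal.log_ofReal_exp (c : ℝ) : ENNReal.log (ENNReal.ofReal (Real.exp c)) = c := by
  rw [ENNReal.log_ofReal_of_pos (Real.exp_pos c), Real.log_exp]

theorem ENNReal.log_le_coe_iff (u : ℝ≥0∞) (c : ℝ) :
    ENNReal.log u ≤ (c : EReal) ↔ u ≤ ENNReal.ofReal (Real.exp c) := by
  rw [← ENNReal.log_ofReal_exp, ENNReal.log_le_log_iff]

theorem ENNReal.coe_le_log_iff (u : ℝ≥0∞) (c : ℝ) :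
    (c : EReal) ≤ ENNReal.log u ↔ ENNReal.ofReal (Real.exp c) ≤ u := by
  rw [← ENNReal.log_ofReal_exp, ENNReal.log_le_log_iff]

theorem inv_natCast_mul_log_le_iff {n : ℕ} (hn : n ≠ 0) (u : ℝ≥0∞) (c : ℝ) :
    (((n : ℝ)⁻¹ : ℝ) : EReal) * ENNReal.log u ≤ (c : EReal) ↔
      u ≤ ENNReal.ofReal (Real.exp (n * c)) := by
  rw [EReal.inv_natCast_mul_le_iff hn, ENNReal.log_le_coe_iff]

theorem le_inv_natCast_mul_log_iff {n : ℕ} (hn : n ≠ 0) (u : ℝ≥0∞) (c : ℝ) :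
    (c : EReal) ≤ (((n : ℝ)⁻¹ : ℝ) : EReal) * ENNReal.log u ↔
      ENNReal.ofReal (Real.exp (n * c)) ≤ u := by
  rw [EReal.le_inv_natCast_mul_iff hn, ENNReal.coe_le_log_iff]

theorem ENNReal.ofReal_exp_add (a b : ℝ) : ENNReal.ofReal (Real.exp (a + b)) =
    ENNReal.ofReal (Real.exp a) * ENNReal.ofReal (Real.exp b) := by
  rw [Real.exp_add, ENNReal.ofReal_mul (Real.exp_pos a).le]

theorem ENNReal.ofReal_exp_rpow (a p : ℝ) :
    ENNReal.ofReal (Real.exp a) ^ p = ENNReal.ofReal (Real.exp (p * a)) := by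
  rw [ENNReal.ofReal_rpow_of_pos (Real.exp_pos a), ← Real.exp_mul, mul_comm]

theorem tendsto_ofReal_exp_natCast_mul {ε : ℝ} (hε : 0 < ε) :
    Tendsto (fun n : ℕ => ENNReal.ofReal (Real.exp (n * ε))) atTop (𝓝 ⊤) :=
  ENNReal.tendsto_ofReal_nhds_top.2
    (Real.tendsto_exp_atTop.comp (tendsto_natCast_atTop_atTop.atTop_mul_const hε))

/-- Constants are negligible on the exponential scale. -/
theorem eventually_mul_ofReal_exp_le {C : ℝ≥0∞} (hC : C ≠ ⊤) {a b : ℝ} (hab : a < b) :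
    ∀ᶠ n : ℕ in atTop, C * ENNReal.ofReal (Real.exp (n * a)) ≤
      ENNReal.ofReal (Real.exp (n * b)) := by
  filter_upwards [(tendsto_ofReal_exp_natCast_mul (sub_pos.2 hab)).eventually
    (lt_mem_nhds hC.lt_top)] with n hn
  calc C * ENNReal.ofReal (Real.exp (n * a))
      ≤ ENNReal.ofReal (Real.exp (n * (b - a))) * ENNReal.ofReal (Real.exp (n * a)) := by
        gcongr
    _ = ENNReal.ofReal (Real.exp (n * b)) := by
        rw [← ENNReal.ofReal_exp_add]; ring_nf

/-- A positive constant is negligible on the exponential scale. -/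
theorem eventually_ofReal_exp_le_mul {C : ℝ≥0∞} (hC : C ≠ 0) {a b : ℝ} (hab : a < b) :
    ∀ᶠ n : ℕ in atTop, ENNReal.ofReal (Real.exp (n * a)) ≤
      C * ENNReal.ofReal (Real.exp (n * b)) := by
  rcases eq_or_ne C ⊤ with rfl | hC'
  · refine .of_forall fun n => ?_
    rw [ENNReal.top_mul (by simp [Real.exp_pos])]
    exact le_top
  filter_upwards [eventually_mul_ofReal_exp_le (ENNReal.inv_ne_top.2 hC) hab] with n hn
  calc ENNReal.ofReal (Real.exp (n * a))
      = C * (C⁻¹ * ENNReal.ofReal (Real.exp (n * a))) := by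
        rw [← mul_assoc, ENNReal.mul_inv_cancel hC hC', one_mul]
    _ ≤ _ := by gcongr

/-- Identification of an exponential rate through two-sided exponential bounds. -/
theorem tendsto_inv_natCast_mul_log {u : ℕ → ℝ≥0∞} {L : EReal}
    (hupper : ∀ c : ℝ, L < c → ∀ᶠ n : ℕ in atTop, u n ≤ ENNReal.ofReal (Real.exp (n * c)))
    (hlower : ∀ c : ℝ, (c : EReal) < L →
      ∀ᶠ n : ℕ in atTop, ENNReal.ofReal (Real.exp (n * c)) ≤ u n) :
    Tendsto (fun n : ℕ => (((n : ℝ)⁻¹ : ℝ) : EReal) * ENNReal.log (u n)) atTop (𝓝 L) := by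
  refine tendsto_order.2 ⟨fun a ha => ?_, fun b hb => ?_⟩
  · obtain ⟨c, hac, hcL⟩ := EReal.lt_iff_exists_real_btwn.1 ha
    filter_upwards [hlower c hcL, eventually_ne_atTop 0] with n hn hn0
    exact hac.trans_le ((le_inv_natCast_mul_log_iff hn0 _ _).2 hn)
  · obtain ⟨c, hLc, hcb⟩ := EReal.lt_iff_exists_real_btwn.1 hb
    filter_upwards [hupper c hLc, eventually_ne_atTop 0] with n hn hn0
    exact ((inv_natCast_mul_log_le_iff hn0 _ _).2 hn).trans_lt hcb

theorem eventually_le_ofReal_exp_of_limsup_lt {u : ℕ → ℝ≥0∞} {c : ℝ}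
    (h : limsup (fun n : ℕ => (((n : ℝ)⁻¹ : ℝ) : EReal) * ENNReal.log (u n)) atTop < c) :
    ∀ᶠ n : ℕ in atTop, u n ≤ ENNReal.ofReal (Real.exp (n * c)) := by
  filter_upwards [eventually_lt_of_limsup_lt h, eventually_ne_atTop 0] with n hn hn0
  exact (inv_natCast_mul_log_le_iff hn0 _ _).1 hn.le

/-- Hölder's inequality on a set, for an exponential integrand. -/
theorem setLIntegral_exp_le_rpow_mul_rpow (ρ : Measure X) {f : X → ℝ} (hf : Measurable f)
    {p q : ℝ} (hpq : p.HolderConjugate q) (S : Set X) (n : ℕ) :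
    ∫⁻ x in S, ENNReal.ofReal (Real.exp (n * f x)) ∂ρ ≤
      (∫⁻ x, ENNReal.ofReal (Real.exp (n * (p * f x))) ∂ρ) ^ (1 / p) * ρ S ^ (1 / q) := by
  have h := ENNReal.lintegral_mul_le_Lp_mul_Lq (ρ.restrict S) hpq
    (f := fun x => ENNReal.ofReal (Real.exp (n * f x))) (g := fun _ => 1)
    (by fun_prop) (by fun_prop)
  simp only [Pi.mul_apply, mul_one, ENNReal.one_rpow, lintegral_one,
    Measure.restrict_apply_univ, ENNReal.ofReal_exp_rpow] at h
  refine h.trans ?_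
  gcongr ?_ ^ _ * _
  · exact one_div_nonneg.2 hpq.nonneg
  · refine (lintegral_mono' Measure.restrict_le_self le_rfl).trans_eq ?_
    simp only [mul_left_comm]

theorem sub_le_of_log_bounds {n : ℕ} (hn : n ≠ 0) {r i : ℝ≥0∞} (hi : i < ⊤) {δ : ℝ}
    (h : -(δ : EReal) ≤ (((n : ℝ)⁻¹ : ℝ) : EReal) * ENNReal.log r + (i : EReal)) :
    ENNReal.ofReal (Real.exp (n * (-δ - i.toReal))) ≤ r := by
  rw [← le_inv_natCast_mul_log_iff hn, EReal.coe_sub, EReal.coe_neg,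
    EReal.coe_ennreal_toReal hi.ne]
  exact EReal.sub_le_of_le_add h

theorem le_of_log_bounds {n : ℕ} (hn : n ≠ 0) {r i : ℝ≥0∞} (hi : i < ⊤) {δ : ℝ}
    (h : (((n : ℝ)⁻¹ : ℝ) : EReal) * ENNReal.log r + (i : EReal) ≤ (δ : EReal)) :
    r ≤ ENNReal.ofReal (Real.exp (n * (δ - i.toReal))) := by
  rw [← inv_natCast_mul_log_le_iff hn, EReal.coe_sub, EReal.coe_ennreal_toReal hi.ne]
  refine (EReal.le_sub_iff_add_le (.inr (by simp)) (.inr (by simp))).2 h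

/-- On a set where the densities converge uniformly, exponential integrals are bounded above
by the essential supremum of `f - I`. -/
theorem eventually_setLIntegral_exp_le {μ : Measure X} [IsProbabilityMeasure μ]
    {ν : ℕ → Measure X} [∀ n, IsProbabilityMeasure (ν n)] (hac : ∀ n, ν n ≪ μ)
    {I : X → ℝ≥0∞} {A B : Set X} (hA : MeasurableSet A) (hB : MeasurableSet B)
    (hIA : ∀ᵐ x ∂μ, x ∈ A → I x < ⊤)
    (hlim : ∀ δ : ℝ, 0 < δ → ∃ N : ℕ, ∀ n ≥ N, ∀ᵐ x ∂μ, x ∈ A →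
      (((n : ℝ)⁻¹ : ℝ) : EReal) * ENNReal.log ((ν n).rnDeriv μ x) + (I x : EReal) ≤ (δ : EReal))
    {f : X → ℝ} (hf : Measurable f) {c : ℝ}
    (hc : essSup (fun x => (f x : EReal) - (I x : EReal)) (μ.restrict B) < c) :
    ∀ᶠ n : ℕ in atTop, ∫⁻ x in B ∩ A, ENNReal.ofReal (Real.exp (n * f x)) ∂ν n ≤
      ENNReal.ofReal (Real.exp (n * c)) := by
  obtain ⟨c', hLc', hc'c⟩ := EReal.lt_iff_exists_real_btwn.1 hc
  have hc'c : c' < c := by exact_mod_cast hc'c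
  obtain ⟨N, hN⟩ := hlim (c - c') (sub_pos.2 hc'c)
  filter_upwards [eventually_ge_atTop N, eventually_ne_atTop 0] with n hn hn0
  have hsup : ∀ᵐ x ∂μ, x ∈ B → (f x : EReal) - (I x : EReal) < c' :=
    (ae_restrict_iff' hB).1 (ae_lt_of_essSup_lt hLc')
  rw [← setLIntegral_rnDeriv_mul (hac n) (by fun_prop) (hB.inter hA)]
  calc ∫⁻ x in B ∩ A, (ν n).rnDeriv μ x * ENNReal.ofReal (Real.exp (n * f x)) ∂μ
      ≤ ∫⁻ _ in B ∩ A, ENNReal.ofReal (Real.exp (n * c)) ∂μ := by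
        refine setLIntegral_mono_ae' (hB.inter hA) ?_
        filter_upwards [hN n hn, hIA, hsup] with x h3 hI hs ⟨hxB, hxA⟩
        have hfI : f x - (I x).toReal < c' := by
          have := hs hxB
          rw [← EReal.coe_ennreal_toReal (hI hxA).ne] at this
          exact_mod_cast this
        refine (mul_le_mul_left (le_of_log_bounds hn0 (hI hxA) (h3 hxA)) _).trans ?_
        rw [← ENNReal.ofReal_exp_add, ← mul_add]
        gcongr
        linarith
    _ ≤ ENNReal.ofReal (Real.exp (n * c)) := by
        rw [setLIntegral_const]
        exact mul_le_of_le_one_right' prob_le_one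

/-- If the densities converge uniformly on each `A k` and the `A k` exhaust `{I < ∞}`, then
exponential integrals are bounded below by the essential supremum of `f - I`. -/
theorem eventually_le_setLIntegral_exp {μ : Measure X} [IsProbabilityMeasure μ]
    {ν : ℕ → Measure X} [∀ n, IsProbabilityMeasure (ν n)] (hac : ∀ n, ν n ≪ μ)
    {I : X → ℝ≥0∞} (hI : Measurable I) {A : ℕ → Set X} (hA : ∀ k, MeasurableSet (A k))
    {B : Set X} (hB : MeasurableSet B) (hcover : {x | I x < ⊤} =ᵐ[μ] ⋃ k, A k)
    (hlim : ∀ k : ℕ, ∀ δ : ℝ, 0 < δ → ∃ N : ℕ, ∀ n ≥ N, ∀ᵐ x ∂μ, x ∈ A k →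
      -(δ : EReal) ≤ (((n : ℝ)⁻¹ : ℝ) : EReal) *
        ENNReal.log ((ν n).rnDeriv μ x) + (I x : EReal))
    {f : X → ℝ} (hf : Measurable f) {c : ℝ}
    (hc : c < essSup (fun x => (f x : EReal) - (I x : EReal)) (μ.restrict B)) :
    ∀ᶠ n : ℕ in atTop, ENNReal.ofReal (Real.exp (n * c)) ≤
      ∫⁻ x in B, ENNReal.ofReal (Real.exp (n * f x)) ∂ν n := by
  obtain ⟨c₂, hcc₂, hc₂⟩ := EReal.lt_iff_exists_real_btwn.1 hc
  have hcc₂ : c < c₂ := by exact_mod_cast hcc₂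
  obtain ⟨c₁, hcc₁, hc₁⟩ := exists_between hcc₂
  set S : Set X := {x | c₂ < f x - (I x).toReal ∧ I x < ⊤}
  have hSm : MeasurableSet S := by
    refine (measurableSet_lt measurable_const (hf.sub hI.ennreal_toReal)).inter
      (measurableSet_lt hI measurable_const)
  obtain ⟨k, hk⟩ : ∃ k, μ (B ∩ S ∩ A k) ≠ 0 := by
    by_contra! h
    refine hc₂.not_ge (essSup_le_of_ae_le _ ((ae_restrict_iff' hB).2 ?_))
    filter_upwards [hcover.mem_iff, measure_eq_zero_iff_ae_notMem.1
      (measure_iUnion_null_iff.2 h)] with x hx hxS hxB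
    by_contra! hlt
    have hIx : I x < ⊤ := by
      refine lt_top_iff_ne_top.2 fun hIx => ?_
      simp [hIx] at hlt
    obtain ⟨k, hxk⟩ := mem_iUnion.1 (hx.1 hIx)
    refine hxS (mem_iUnion.2 ⟨k, ⟨hxB, ?_, hIx⟩, hxk⟩)
    rw [← EReal.coe_ennreal_toReal hIx.ne] at hlt
    exact_mod_cast hlt
  obtain ⟨N, hN⟩ := hlim k (c₂ - c₁) (sub_pos.2 hc₁)
  have hTm : MeasurableSet (B ∩ S ∩ A k) := (hB.inter hSm).inter (hA k)
  filter_upwards [eventually_ge_atTop N, eventually_ne_atTop 0,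
    eventually_ofReal_exp_le_mul hk hcc₁] with n hn hn0 hexp
  calc ENNReal.ofReal (Real.exp (n * c))
      ≤ μ (B ∩ S ∩ A k) * ENNReal.ofReal (Real.exp (n * c₁)) := hexp
    _ = ∫⁻ _ in B ∩ S ∩ A k, ENNReal.ofReal (Real.exp (n * c₁)) ∂μ := by
        rw [setLIntegral_const, mul_comm]
    _ ≤ ∫⁻ x in B ∩ S ∩ A k,
          (ν n).rnDeriv μ x * ENNReal.ofReal (Real.exp (n * f x)) ∂μ := by
        refine setLIntegral_mono_ae' hTm ?_
        filter_upwards [hN n hn] with x h3 ⟨⟨_, hxS, hIx⟩, hxA⟩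
        refine le_trans ?_ (mul_le_mul_left (sub_le_of_log_bounds hn0 hIx (h3 hxA)) _)
        rw [← ENNReal.ofReal_exp_add, ← mul_add]
        gcongr
        linarith
    _ = ∫⁻ x in B ∩ S ∩ A k, ENNReal.ofReal (Real.exp (n * f x)) ∂ν n :=
        setLIntegral_rnDeriv_mul (hac n) (by fun_prop) hTm
    _ ≤ ∫⁻ x in B, ENNReal.ofReal (Real.exp (n * f x)) ∂ν n :=
        lintegral_mono_set (inter_subset_left.trans inter_subset_left)

/-- Under an exponential moment condition, sets that are exponentially negligible of arbitrarily
high order do not contribute to exponential integrals. -/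
theorem exists_eventually_setLIntegral_compl_exp_le {ν : ℕ → Measure X} {A : ℕ → Set X}
    (htight : Tendsto (fun k : ℕ => limsup (fun n : ℕ => (((n : ℝ)⁻¹ : ℝ) : EReal) *
      ENNReal.log (ν n (A k)ᶜ)) atTop) atTop (𝓝 (⊥ : EReal)))
    {f : X → ℝ} (hf : Measurable f) {t : ℝ} (ht : 1 < t)
    (hmoment : varadhan ν (fun x => t * f x) < ⊤) (c : ℝ) :
    ∃ k, ∀ᶠ n : ℕ in atTop, ∫⁻ x in (A k)ᶜ, ENNReal.ofReal (Real.exp (n * f x)) ∂ν n ≤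
      ENNReal.ofReal (Real.exp (n * c)) := by
  obtain ⟨M, hM, -⟩ := EReal.lt_iff_exists_real_btwn.1 hmoment
  have hpq := Real.HolderConjugate.conjExponent ht
  set q := t.conjExponent
  obtain ⟨k, hk⟩ := (htight.eventually
    (gt_mem_nhds (EReal.bot_lt_coe (q * (c - 1 / t * M))))).exists
  refine ⟨k, ?_⟩
  filter_upwards [eventually_le_ofReal_exp_of_limsup_lt hM,
    eventually_le_ofReal_exp_of_limsup_lt hk] with n hMn hkn
  calc ∫⁻ x in (A k)ᶜ, ENNReal.ofReal (Real.exp (n * f x)) ∂ν n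
      ≤ (∫⁻ x, ENNReal.ofReal (Real.exp (n * (t * f x))) ∂ν n) ^ (1 / t) *
          ν n (A k)ᶜ ^ (1 / q) := setLIntegral_exp_le_rpow_mul_rpow _ hf hpq _ n
    _ ≤ ENNReal.ofReal (Real.exp (n * M)) ^ (1 / t) *
          ENNReal.ofReal (Real.exp (n * (q * (c - 1 / t * M)))) ^ (1 / q) :=
        mul_le_mul' (ENNReal.rpow_le_rpow hMn (one_div_nonneg.2 hpq.nonneg))
          (ENNReal.rpow_le_rpow hkn (one_div_nonneg.2 hpq.symm.nonneg))
    _ = ENNReal.ofReal (Real.exp (n * c)) := by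
        rw [ENNReal.ofReal_exp_rpow, ENNReal.ofReal_exp_rpow, ← ENNReal.ofReal_exp_add]
        have := hpq.symm.ne_zero
        congr 2
        field_simp
        ring

/-- The Laplace principle localized to a measurable set. -/
theorem tendsto_inv_mul_log_setLIntegral_exp
    {μ : Measure X} [IsProbabilityMeasure μ]
    {ν : ℕ → Measure X} [∀ n, IsProbabilityMeasure (ν n)] (hac : ∀ n, ν n ≪ μ)
    {I : X → ℝ≥0∞} (hI : Measurable I) {A : ℕ → Set X} (hA : ∀ k, MeasurableSet (A k))
    (hcover : {x | I x < ⊤} =ᵐ[μ] ⋃ k, A k)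
    (htight : Tendsto (fun k : ℕ => limsup (fun n : ℕ => (((n : ℝ)⁻¹ : ℝ) : EReal) *
      ENNReal.log (ν n (A k)ᶜ)) atTop) atTop (𝓝 (⊥ : EReal)))
    (hlim : ∀ k : ℕ, ∀ δ : ℝ, 0 < δ → ∃ N : ℕ, ∀ n ≥ N, ∀ᵐ x ∂μ, x ∈ A k →
        (-(δ : EReal) ≤ (((n : ℝ)⁻¹ : ℝ) : EReal) *
            ENNReal.log ((ν n).rnDeriv μ x) + (I x : EReal) ∧
          (((n : ℝ)⁻¹ : ℝ) : EReal) *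
            ENNReal.log ((ν n).rnDeriv μ x) + (I x : EReal) ≤ (δ : EReal)))
    {B : Set X} (hB : MeasurableSet B) {f : X → ℝ} (hf : Measurable f) {t : ℝ} (ht : 1 < t)
    (hmoment : varadhan ν (fun x => t * f x) < ⊤) :
    Tendsto (fun n : ℕ => (((n : ℝ)⁻¹ : ℝ) : EReal) *
        ENNReal.log (∫⁻ x in B, ENNReal.ofReal (Real.exp (n * f x)) ∂ν n)) atTop
      (𝓝 (essSup (fun x => (f x : EReal) - (I x : EReal)) (μ.restrict B))) := by
  refine tendsto_inv_natCast_mul_log (fun c hc => ?_) fun c hc =>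
    eventually_le_setLIntegral_exp hac hI hA hB hcover (fun k δ hδ => ?_) hf hc
  · obtain ⟨c', hLc', hc'c⟩ := EReal.lt_iff_exists_real_btwn.1 hc
    have hc'c : c' < c := by exact_mod_cast hc'c
    obtain ⟨k, hk⟩ := exists_eventually_setLIntegral_compl_exp_le htight hf ht hmoment c'
    have hIA : ∀ᵐ x ∂μ, x ∈ A k → I x < ⊤ := by
      filter_upwards [hcover.mem_iff] with x hx hxk using hx.2 (mem_iUnion.2 ⟨k, hxk⟩)
    have hmain := eventually_setLIntegral_exp_le hac (hA k) hB hIA (fun δ hδ =>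
      (hlim k δ hδ).imp fun N hN n hn => (hN n hn).mono fun x hx hxA => (hx hxA).2) hf hLc'
    filter_upwards [hmain, hk, eventually_mul_ofReal_exp_le (ENNReal.ofNat_ne_top (n := 2)) hc'c]
      with n h₁ h₂ h₃
    refine le_trans ?_ h₃
    rw [two_mul, ← lintegral_inter_add_sdiff _ B (hA k)]
    exact add_le_add h₁ ((lintegral_mono_set fun x hx => hx.2).trans h₂)
  · exact (hlim k δ hδ).imp fun N hN n hn => (hN n hn).mono fun x hx hxA => (hx hxA).1

/-- Criterion for the sharp LDP: if `{I < ∞} = ⋃ k, A k` up to a μ-null set,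
`limsup_n (1/n) log ν_n((A k)ᶜ) → -∞` as `k → ∞`, and `(1/n) log (dν_n/dμ) → -I`
μ-a.s. uniformly on each `A k`, then `(ν n)` satisfies the sharp LDP with rate `I`
(the limit `lim_n (1/n) log ν_n(B)` exists and equals `- ess.inf_B I` for all measurable
`B`), as well as the Laplace principle on `L^φ`. -/
theorem sharpLDP_criterion
    (μ : Measure X) [IsProbabilityMeasure μ]
    (ν : ℕ → Measure X) (hprob : ∀ n, IsProbabilityMeasure (ν n))
    (hac : ∀ n, ν n ≪ μ)
    (I : X → ℝ≥0∞) (hI : Measurable I)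
    (A : ℕ → Set X) (hA : ∀ k, MeasurableSet (A k))
    (h1 : {x | I x < ⊤} =ᵐ[μ] ⋃ k, A k)
    (h2 : Tendsto (fun k : ℕ =>
        Filter.limsup (fun n : ℕ => (((n : ℝ)⁻¹ : ℝ) : EReal) *
          ENNReal.log (ν n (A k)ᶜ)) atTop) atTop (𝓝 (⊥ : EReal)))
    (h3 : ∀ k : ℕ, ∀ δ : ℝ, 0 < δ → ∃ N : ℕ, ∀ n ≥ N, ∀ᵐ x ∂μ, x ∈ A k →
        (-(δ : EReal) ≤ (((n : ℝ)⁻¹ : ℝ) : EReal) *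
            ENNReal.log ((ν n).rnDeriv μ x) + (I x : EReal) ∧
          (((n : ℝ)⁻¹ : ℝ) : EReal) *
            ENNReal.log ((ν n).rnDeriv μ x) + (I x : EReal) ≤ (δ : EReal))) :
    (∀ B : Set X, MeasurableSet B →
      Tendsto (fun n : ℕ => (((n : ℝ)⁻¹ : ℝ) : EReal) * ENNReal.log (ν n B)) atTop
        (𝓝 (-(essInf (fun x => (I x : EReal)) (μ.restrict B))))) ∧
    (∀ f : X → ℝ, Measurable f →
      (∃ t : ℝ, 1 < t ∧ varadhan ν (fun x => t * f x) < ⊤) →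
      Tendsto (fun n : ℕ => (((n : ℝ)⁻¹ : ℝ) : EReal) *
          ENNReal.log (∫⁻ x, ENNReal.ofReal (Real.exp ((n : ℝ) * f x)) ∂ν n)) atTop
        (𝓝 (essSup (fun x => (f x : EReal) - (I x : EReal)) μ))) := by
  refine ⟨fun B hB => ?_, fun f hf ⟨t, ht, hft⟩ => ?_⟩
  · have h := tendsto_inv_mul_log_setLIntegral_exp hac hI hA h1 h2 h3 hB
      (measurable_const (a := (0 : ℝ))) one_lt_two (by simp [varadhan])
    have hneg : -(essInf (fun x => (I x : EReal)) (μ.restrict B)) =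
        essSup (fun x => ((0 : ℝ) : EReal) - (I x : EReal)) (μ.restrict B) := by
      simp only [EReal.coe_zero, zero_sub]
      exact OrderIso.essInf_apply (fun x => (I x : EReal)) (μ.restrict B) EReal.negOrderIso
    rw [hneg]
    simpa using h
  · simpa using tendsto_inv_mul_log_setLIntegral_exp hac hI hA h1 h2 h3 MeasurableSet.univ hf
      ht hft
end
end
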